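/- arXiv:2508.07113 — 2 statements merged into one kernel-verified Lean document; each statement's English description precedes it below -/
import Mathlib

section
/- Let p be a prime, n ≥ 1, q = p^n, and let S ⊆ 𝔽_q be a subset with #S > 2. Then 𝒫(S, q) ≠ ∅ (i.e., there exists an MVSP F ∈ 𝔽_q[x] with value set V_F = S) if and only if there exist a divisor k ≥ 1 of n, an 𝔽_{p^k}-subspace U of 𝔽_q with 1 ∈ U, a positive divisor v of p^k − 1, and elements a, b ∈ 𝔽_q with a ≠ 0 such that S = {a·u^v + b : u ∈ U}. -/
open Polynomial

/-- The value set of a polynomial over a finite field. -/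
def valueSet {F : Type*} [Field F] [Fintype F] [DecidableEq F] (f : F[X]) : Finset F :=
  Finset.image (fun a => f.eval a) Finset.univ

/-- A minimal value set polynomial (MVSP): a nonconstant polynomial whose value set has
the minimal possible size `⌊(q-1)/deg f⌋ + 1`. -/
def IsMVSP {F : Type*} [Field F] [Fintype F] [DecidableEq F] (f : F[X]) : Prop :=
  0 < f.natDegree ∧ (valueSet f).card = (Fintype.card F - 1) / f.natDegree + 1

/-- `MVSPset S` is the set `𝒫(S, q)` of all MVSPs with value set `S`. -/
def MVSPset {F : Type*} [Field F] [Fintype F] [DecidableEq F] (S : Finset F) : Set F[X] :=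
  {f | IsMVSP f ∧ valueSet f = S}

/-- `U` is a subspace over the subfield `{c : c ^ r = c}` (with `r = p ^ k`):
an additive subgroup closed under multiplication by elements of that subfield. -/
def IsSubspaceOver {F : Type*} [Field F] (r : ℕ) (U : Set F) : Prop :=
  (0 : F) ∈ U ∧ (∀ x ∈ U, ∀ y ∈ U, x + y ∈ U) ∧ (∀ x ∈ U, -x ∈ U) ∧
    (∀ c : F, c ^ r = c → ∀ x ∈ U, c * x ∈ U)

/-- An `r`-linearized polynomial (with `r = q` or `r = p ^ k`): of the form `Σ aᵢ x ^ (r ^ i)`. -/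
def IsLinearized {F : Type*} [Field F] (r : ℕ) (M : F[X]) : Prop :=
  ∃ (s : ℕ) (a : ℕ → F), M = ∑ i ∈ Finset.range (s + 1), C (a i) * X ^ r ^ i

namespace MV

lemma const_root {F : Type*} [Field F] [Finite F] (p : ℕ) [Fact p.Prime] [CharP F p] (c : F) :
    ∃ c' : F, c = c' ^ p := by
  obtain ⟨x, hx⟩ := (frobeniusEquiv F p).surjective c
  exact ⟨x, by rw [← hx]; simp [frobenius_def]⟩

lemma exists_pow {F : Type*} [Field F] [Finite F] (p : ℕ) [Fact p.Prime] [CharP F p]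
    (g : F[X]) (h : derivative g = 0) : ∃ g' : F[X], g = g' ^ p := by
  have h1 := expand_contract p h (Fact.out : p.Prime).ne_zero
  rw [polynomial_expand_eq] at h1
  exact ⟨_, h1.symm⟩

lemma exists_X_pow {F : Type*} [Field F] [Finite F] (p : ℕ) [Fact p.Prime] [CharP F p]
    (E : F[X]) (ρ : ℕ) (hρ : ρ < p) (h : ∀ l, E.coeff l ≠ 0 → l % p = ρ) :
    ∃ E' : F[X], E = X ^ ρ * E' ^ p := by
  have h1 : X ^ ρ ∣ E := by
    rw [X_pow_dvd_iff]
    intro d hd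
    by_contra hc
    have := h d hc
    rw [Nat.mod_eq_of_lt (by omega)] at this
    omega
  obtain ⟨E1, rfl⟩ := h1
  obtain ⟨g, hg⟩ := exists_pow p E1 (by
    ext m
    rw [coeff_derivative, coeff_zero]
    by_cases hc : E1.coeff (m+1) = 0
    · simp [hc]
    · have := h (m+1+ρ) (by rw [coeff_X_pow_mul]; exact hc)
      have h2 : p ∣ m + 1 := by
        have h3 : (m + 1 + ρ) ≡ 0 + ρ [MOD p] := by
          unfold Nat.ModEq; rw [this, zero_add, Nat.mod_eq_of_lt hρ]
        exact (Nat.modEq_zero_iff_dvd).1 (Nat.ModEq.add_right_cancel' ρ h3)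
      have h4 : ((m + 1 : ℕ) : F) = 0 := (CharP.cast_eq_zero_iff F p _).2 h2
      push_cast at h4
      rw [h4, mul_zero])
  exact ⟨g, by rw [hg]⟩

lemma decouple {F : Type*} [Field F] (f : F[X]) (N : ℕ) :
    ∀ (c : ℕ → F[X]) (r : F[X]), r.degree < f.degree → (∀ i, (c i).degree < f.degree) →
      ∑ i ∈ Finset.range N, c i * f ^ i = r → ∀ i < N, c i = if i = 0 then r else 0 := by
  induction N with
  | zero => intro c r _ _ _ i hi; omega
  | succ N ih =>
    intro c r hr hc hs i hi
    rw [Finset.sum_range_succ'] at hs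
    have h1 : ∑ i ∈ Finset.range N, c (i+1) * f ^ (i+1) = f * ∑ i ∈ Finset.range N, c (i+1) * f ^ i := by
      rw [Finset.mul_sum]; exact Finset.sum_congr rfl fun i _ => by ring
    rw [h1] at hs
    have h2 : f ∣ r - c 0 := ⟨∑ i ∈ Finset.range N, c (i+1) * f ^ i, by rw [← hs]; ring⟩
    have h3 : r - c 0 = 0 := by
      by_contra hne
      have := degree_le_of_dvd h2 hne
      have h4 := degree_sub_le r (c 0)
      exact absurd (this.trans h4) (not_le.2 (max_lt hr (hc 0)))
    have h0 : c 0 = r := (sub_eq_zero.1 h3).symm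
    have hf : f ≠ 0 := by rintro rfl; simp at hr
    have h5 : ∑ i ∈ Finset.range N, c (i+1) * f ^ i = 0 := by
      have : f * ∑ i ∈ Finset.range N, c (i+1) * f ^ i = 0 := by
        rw [h0] at hs; simpa using hs
      exact (mul_eq_zero.1 this).resolve_left hf
    rcases i with _ | i
    · simp [h0]
    · have := ih (fun i => c (i+1)) 0 (by rw [degree_zero]; exact bot_lt_iff_ne_bot.2 (by simpa using hf))
        (fun i => hc _) h5 i (by omega)
      simpa using this

lemma coeff_pow_p {F : Type*} [Field F] (p : ℕ) [Fact p.Prime] [CharP F p] (E : F[X])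
    (s j : ℕ) (h : (E ^ p ^ s).coeff j ≠ 0) : ∃ l, j = p ^ s * l ∧ E.coeff l ≠ 0 := by
  have hp := (Fact.out : p.Prime)
  rw [← map_iterateFrobenius_expand p, coeff_map, coeff_expand (pow_pos hp.pos s)] at h
  split_ifs at h with hd
  · obtain ⟨l, rfl⟩ := hd
    refine ⟨l, rfl, fun h0 => h ?_⟩
    rw [Nat.mul_div_cancel_left _ (pow_pos hp.pos s), h0, map_zero]
  · simp at h

lemma deriv_pow_p {F : Type*} [Field F] (p : ℕ) [Fact p.Prime] [CharP F p] (E : F[X]) :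
    derivative (E ^ p) = 0 := by
  simp [derivative_pow]

lemma cast_zero {F : Type*} [Field F] (p : ℕ) [CharP F p] (m : ℕ) : (m : F) = 0 ↔ p ∣ m :=
  CharP.cast_eq_zero_iff F p m
end MV

namespace MV

/-- Level data for the separable case. -/
def Lev1 {F : Type*} [Field F] (p q : ℕ) (f T : F[X]) (s : ℕ) : Prop :=
  ∃ (g T0 A β : F[X]) (τ : F) (Q : ℕ), p ^ s * Q = q ∧ derivative f = g ^ p ^ s ∧
    T = T0 + A ^ p ^ s ∧ (∀ j, T0.coeff j ≠ 0 → ∃ i, j = p ^ i) ∧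
    A.comp f = C τ * (X ^ Q * g + β) ∧ τ ≠ 0 ∧ p * β.natDegree ≤ f.natDegree

lemma deg_lt_of_nat {F : Type*} [Field F] {a f : F[X]} (h : a.natDegree < f.natDegree) :
    a.degree < f.degree := degree_lt_degree h

lemma comp_sum {F : Type*} [Field F] (A f : F[X]) (N : ℕ) (h : A.natDegree < N) :
    A.comp f = ∑ i ∈ Finset.range N, C (A.coeff i) * f ^ i := by
  rw [comp, eval₂_eq_sum_range' C h]

lemma step1_alg {F : Type*} [Field F] (p q : ℕ) [Fact p.Prime] [CharP F p]
    (f T : F[X]) (t : F) (hd : 0 < f.natDegree) (hf' : derivative f ≠ 0)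
    (hTf : T.comp f = - C t * (X ^ q - X) * derivative f)
    (hroot : ∀ γ, T.eval γ = 0 → ∃ α, f.eval α = γ ∧ (derivative f).eval α ≠ 0)
    (s : ℕ) (hs : 1 ≤ s) (g A β : F[X]) (τ : F) (Q : ℕ)
    (hg : derivative f = g ^ p ^ s) (hA : A.comp f = C τ * (X ^ Q * g + β))
    (hQ : p ∣ Q) (hβ : p * β.natDegree ≤ f.natDegree) (hR : 2 ≤ A.natDegree) :
    derivative g = 0 ∧ ∀ j : ℕ, 2 ≤ j → (j : F) * A.coeff j = 0 := by
  have hp := (Fact.out : p.Prime)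
  set P := p ^ s with hP
  have hP2 : 2 ≤ P := hp.two_le.trans (Nat.le_self_pow (by omega) p)
  have hf0 : f ≠ 0 := by rintro rfl; simp at hd
  have hg0 : g ≠ 0 := by rintro rfl; rw [zero_pow (by omega)] at hg; exact hf' hg
  have hQ0 : (Q : F) = 0 := (cast_zero p Q).2 hQ
  -- degrees
  have hgd : P * g.natDegree ≤ f.natDegree - 1 := by
    rw [← natDegree_pow, ← hg]; exact natDegree_derivative_le f
  have h2g : 2 * g.natDegree ≤ P * g.natDegree := Nat.mul_le_mul_right _ hP2
  have h2b : 2 * β.natDegree ≤ p * β.natDegree := Nat.mul_le_mul_right _ hp.two_le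
  -- derivative identity
  have hX : derivative ((X : F[X]) ^ Q) = 0 := by
    rw [derivative_X_pow, hQ0]; simp
  have hder := congrArg derivative hA
  rw [derivative_comp, derivative_C_mul, derivative_add, derivative_mul, hX, zero_mul, zero_add, hg] at hder
  set k := C τ * (derivative β * g - β * derivative g) with hk
  have hid : (derivative A).comp f * g ^ (P + 1) - A.comp f * derivative g = k := by
    rw [hA, hk, pow_succ]
    linear_combination g * hder
  have hkd : k.natDegree < f.natDegree := by
    have h1 : k.natDegree ≤ β.natDegree + g.natDegree := by
      refine (natDegree_C_mul_le _ _).trans ?_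
      refine (natDegree_sub_le _ _).trans (max_le ?_ ?_)
      · refine natDegree_mul_le.trans ?_
        have := natDegree_derivative_le β; omega
      · refine natDegree_mul_le.trans ?_
        have := natDegree_derivative_le g; omega
    omega
  set a := g ^ (P + 1) / f with ha
  set b := g ^ (P + 1) % f with hb
  have hab : g ^ (P + 1) = a * f + b := by
    rw [ha, hb, mul_comm]; exact (EuclideanDomain.div_add_mod _ _).symm
  have hbd : b.degree < f.degree := EuclideanDomain.mod_lt _ hf0
  have had : a.degree < f.degree := by
    by_cases ha0 : a = 0
    · rw [ha0, degree_zero]; exact bot_lt_iff_ne_bot.2 (by simpa using hf0)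
    apply deg_lt_of_nat
    have h1 : (a * f).natDegree ≤ max (g ^ (P+1)).natDegree b.natDegree := by
      have : a * f = g ^ (P+1) - b := by rw [hab]; ring
      rw [this]; exact natDegree_sub_le _ _
    rw [natDegree_mul ha0 hf0, natDegree_pow] at h1
    have h2 : b.natDegree < f.natDegree := by
      by_cases hb0 : b = 0
      · rw [hb0]; simpa using hd
      · exact natDegree_lt_natDegree hb0 hbd
    have h3 : (P + 1) * g.natDegree = P * g.natDegree + g.natDegree := by ring
    rw [h3] at h1
    omega
  have hg'd : (derivative g).natDegree < f.natDegree := by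
    have := natDegree_derivative_le g; omega
  set N := A.natDegree + 1 with hN
  set c : ℕ → F[X] := fun i => C ((i : F) * A.coeff i) * a + C (((i : F) + 1) * A.coeff (i+1)) * b
    - C (A.coeff i) * derivative g with hc
  have hsum : ∑ i ∈ Finset.range N, c i * f ^ i = k := by
    have e1 : (X * derivative A).comp f = ∑ i ∈ Finset.range N, C ((i:F) * A.coeff i) * f ^ i := by
      rw [comp_sum _ f N]
      · refine Finset.sum_congr rfl fun i _ => ?_
        rcases i with _ | i
        · simp
        · rw [coeff_X_mul, coeff_derivative]; push_cast; ring_nf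
      · refine lt_of_le_of_lt natDegree_mul_le ?_
        have := natDegree_derivative_le A
        rw [natDegree_X]; omega
    have e2 : (derivative A).comp f = ∑ i ∈ Finset.range N, C (((i:F)+1) * A.coeff (i+1)) * f ^ i := by
      rw [comp_sum _ f N]
      · refine Finset.sum_congr rfl fun i _ => ?_
        rw [coeff_derivative]; ring_nf
      · have := natDegree_derivative_le A; omega
    have e3 := comp_sum A f N (by omega)
    calc ∑ i ∈ Finset.range N, c i * f ^ i
        = (X * derivative A).comp f * a + (derivative A).comp f * b - A.comp f * derivative g := by
          rw [e1, e2, e3, Finset.sum_mul, Finset.sum_mul, Finset.sum_mul, ← Finset.sum_add_distrib,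
            ← Finset.sum_sub_distrib]
          exact Finset.sum_congr rfl fun i _ => by rw [hc]; ring
      _ = k := by
          rw [← hid, hab, mul_comp, X_comp]; ring
  have hcd : ∀ i, (c i).degree < f.degree := by
    intro i
    have hC : ∀ (x : F) (y : F[X]), y.degree < f.degree → (C x * y).degree < f.degree := by
      intro x y hy
      rw [← smul_eq_C_mul]; exact lt_of_le_of_lt (degree_smul_le x y) hy
    refine lt_of_le_of_lt (degree_sub_le _ _) (max_lt (lt_of_le_of_lt (degree_add_le _ _)
      (max_lt (hC _ _ had) (hC _ _ hbd))) (hC _ _ (deg_lt_of_nat hg'd)))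
  have hdec := decouple f N c k (deg_lt_of_nat hkd) hcd hsum
  have hdec1 : ∀ i, 1 ≤ i → c i = 0 := by
    intro i hi
    by_cases hiN : i < N
    · have := hdec i hiN
      rwa [if_neg (by omega)] at this
    · have h1 : A.coeff i = 0 := coeff_eq_zero_of_natDegree_lt (by omega)
      have h2 : A.coeff (i+1) = 0 := coeff_eq_zero_of_natDegree_lt (by omega)
      simp [hc, h1, h2]
  set R := A.natDegree with hRR
  have hAR : A.coeff R ≠ 0 := by
    rw [hRR, coeff_natDegree, Ne, leadingCoeff_eq_zero]; rintro rfl; simp at hRR; omega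
  have hAR1 : A.coeff (R+1) = 0 := coeff_eq_zero_of_natDegree_lt (by omega)
  have htop : derivative g = C (R : F) * a := by
    have h := hdec1 R (by omega)
    simp only [hc, hAR1, mul_zero, C_0, zero_mul, add_zero] at h
    have h2 : C (A.coeff R) * (C (R:F) * a - derivative g) = 0 := by
      rw [← h, C_mul]; ring
    have h3 := (mul_eq_zero.1 h2).resolve_left (by simpa using hAR)
    exact (sub_eq_zero.1 h3).symm
  by_cases ha0 : a = 0
  · have hg' : derivative g = 0 := by rw [htop, ha0, mul_zero]
    refine ⟨hg', fun j hj => ?_⟩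
    have h := hdec1 (j-1) (by omega)
    have hb0 : b ≠ 0 := by
      intro hb0; rw [ha0, hb0] at hab; simp at hab; exact hg0 hab
    simp only [hc, ha0, hg', mul_zero, zero_add, sub_zero] at h
    have h2 := (mul_eq_zero.1 h).resolve_right hb0
    rw [C_eq_zero, show j - 1 + 1 = j by omega] at h2
    rw [← h2]; congr 1
    have : ((j - 1 + 1 : ℕ) : F) = j := by rw [show j - 1 + 1 = j by omega]
    rw [← this]; push_cast; ring
  by_cases hRF : (R : F) = 0
  · have hg' : derivative g = 0 := by rw [htop, hRF]; simp
    refine ⟨hg', ?_⟩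
    have key : ∀ m j : ℕ, 1 ≤ j → R + 1 - j = m → (j : F) * A.coeff j = 0 := by
      intro m
      induction m with
      | zero =>
        intro j hj hm
        rw [coeff_eq_zero_of_natDegree_lt (show A.natDegree < j by omega), mul_zero]
      | succ m ih =>
        intro j hj hm
        have h1 := ih (j+1) (by omega) (by omega)
        have h := hdec1 j hj
        push_cast at h1
        simp only [hc, hg', mul_zero, sub_zero, h1, C_0, zero_mul, add_zero] at h
        exact C_eq_zero.1 ((mul_eq_zero.1 h).resolve_right ha0)
    exact fun j hj => key _ j (by omega) rfl
  exfalso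
  have hb' : ∃ β₀ : F, b = C β₀ * a := by
    have h := hdec1 (R-1) (by omega)
    have hcast : ((R - 1 : ℕ) : F) = R - 1 := by
      rw [Nat.cast_sub (by omega)]; simp
    simp only [hc, htop, hcast, show R - 1 + 1 = R by omega, sub_add_cancel] at h
    have hne : (R : F) * A.coeff R ≠ 0 := mul_ne_zero hRF hAR
    refine ⟨A.coeff (R-1) / ((R : F) * A.coeff R), ?_⟩
    have h2 : C ((R : F) * A.coeff R) * b = C (A.coeff (R-1)) * a := by
      rw [C_mul, C_sub, C_1] at h
      linear_combination h
    have h3 : b = C ((R : F) * A.coeff R)⁻¹ * (C ((R : F) * A.coeff R) * b) := by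
      rw [← mul_assoc, ← C_mul, inv_mul_cancel₀ hne, C_1, one_mul]
    rw [h3, h2, ← mul_assoc, ← C_mul, div_eq_inv_mul]
  obtain ⟨β₀, hβ₀⟩ := hb'
  have hfac : f + C β₀ ∣ g ^ (P + 1) := ⟨a, by rw [hab, hβ₀]; ring⟩
  have hfd : (f + C β₀).natDegree = f.natDegree := natDegree_add_C
  by_cases hT : T.eval (-β₀) = 0
  · obtain ⟨α, h1, h2⟩ := hroot _ hT
    rw [hg, eval_pow] at h2
    obtain ⟨e, he⟩ := hfac
    have := congrArg (eval α) he
    rw [eval_pow, eval_mul, eval_add, h1, eval_C, neg_add_cancel, zero_mul] at this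
    exact h2 (by rw [(pow_eq_zero_iff (by omega)).1 this, zero_pow (by omega)])
  · have h1 : f + C β₀ ∣ T.comp f - C (T.eval (-β₀)) := by
      have h2 : X - C (-β₀) ∣ T - C (T.eval (-β₀)) := X_sub_C_dvd_sub_C_eval
      obtain ⟨e, he⟩ := h2
      refine ⟨e.comp f, ?_⟩
      have := congrArg (fun x => x.comp f) he
      simpa using this
    have h3 : f + C β₀ ∣ T.comp f * g := by
      rw [hTf, hg]
      have : -C t * (X ^ q - X) * g ^ P * g = -C t * (X ^ q - X) * g ^ (P+1) := by ring
      rw [this]; exact hfac.mul_left _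
    have h4 : f + C β₀ ∣ C (T.eval (-β₀)) * g := by
      have := dvd_sub h3 (h1.mul_right g)
      convert this using 1; ring
    have h5 : f + C β₀ ∣ g := by
      obtain ⟨e, he⟩ := h4
      refine ⟨C (T.eval (-β₀))⁻¹ * e, ?_⟩
      calc g = C (T.eval (-β₀))⁻¹ * (C (T.eval (-β₀)) * g) := by
            rw [← mul_assoc, ← C_mul, inv_mul_cancel₀ hT, C_1, one_mul]
        _ = _ := by rw [he]; ring
    have := natDegree_le_of_dvd h5 hg0
    omega
end MV

namespace MV

lemma coeff_add_ne {F : Type*} [Field F] {a b : F[X]} {j : ℕ} (h : (a + b).coeff j ≠ 0) :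
    a.coeff j ≠ 0 ∨ b.coeff j ≠ 0 := by
  by_contra hc
  push Not at hc
  rw [coeff_add, hc.1, hc.2, add_zero] at h
  exact h rfl

lemma step1 {F : Type*} [Field F] [Finite F] (p q : ℕ) [Fact p.Prime] [CharP F p]
    (f T : F[X]) (t : F) (hd : 0 < f.natDegree) (hf' : derivative f ≠ 0)
    (hTf : T.comp f = - C t * (X ^ q - X) * derivative f)
    (hroot : ∀ γ, T.eval γ = 0 → ∃ α, f.eval α = γ ∧ (derivative f).eval α ≠ 0)
    (s : ℕ) (hs : 1 ≤ s) (hsq : p ^ (s+1) ∣ q) (h : Lev1 p q f T s) :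
    Lev1 p q f T (s+1) ∨ (∀ j, j ≠ 0 → T.coeff j ≠ 0 → ∃ i, j = p ^ i) := by
  have hp := (Fact.out : p.Prime)
  obtain ⟨g, T0, A, β, τ, Q, hPQ, hg, hT, hT0, hA, hτ, hβ⟩ := h
  have hQ : p ∣ Q := by
    rw [← hPQ, pow_succ] at hsq
    exact Nat.dvd_of_mul_dvd_mul_left (pow_pos hp.pos s) hsq
  by_cases hR : 2 ≤ A.natDegree
  swap
  · right
    intro j hj hc
    rw [hT] at hc
    rcases coeff_add_ne hc with h1 | h1
    · exact hT0 j h1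
    · obtain ⟨l, rfl, hl⟩ := coeff_pow_p p A s j h1
      have := le_natDegree_of_ne_zero hl
      have h2 : l ≠ 0 := by rintro rfl; simp at hj
      exact ⟨s, by rw [show l = 1 by omega, mul_one]⟩
  left
  obtain ⟨hg', hAj⟩ := step1_alg p q f T t hd hf' hTf hroot s hs g A β τ Q hg hA hQ hβ hR
  obtain ⟨g₁, rfl⟩ := exists_pow p g hg'
  obtain ⟨A₁, hA₁⟩ := exists_pow p (A - C (A.coeff 1) * X) (by
    ext m
    rw [coeff_derivative, coeff_sub, coeff_C_mul, coeff_X, coeff_zero]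
    rcases m with _ | m
    · simp
    · have h1 := hAj (m+2) (by omega)
      rw [if_neg (by omega), mul_zero, sub_zero, mul_comm, ← h1]
      push_cast; ring)
  obtain ⟨τ₁, rfl⟩ := const_root p τ
  obtain ⟨Q₁, rfl⟩ := hQ
  have hτ₁ : τ₁ ≠ 0 := by rintro rfl; exact hτ (zero_pow hp.ne_zero)
  set a1 := A.coeff 1
  have hAe : A = C a1 * X + A₁ ^ p := by rw [← hA₁]; ring
  set Y := A₁.comp f - C τ₁ * X ^ Q₁ * g₁ with hY
  have hYp : Y ^ p = C (τ₁ ^ p) * β - C a1 * f := by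
    rw [hY, sub_pow_char]
    rw [hAe] at hA
    simp only [add_comp, mul_comp, C_comp, X_comp, pow_comp] at hA
    rw [mul_pow, mul_pow, ← C_pow, ← pow_mul, mul_comm Q₁ p]
    linear_combination hA
  refine ⟨g₁, T0 + C (a1 ^ p ^ s) * X ^ p ^ s, A₁, C τ₁⁻¹ * Y, τ₁, Q₁, ?_, ?_, ?_, ?_, ?_, hτ₁, ?_⟩
  · rw [← hPQ]; ring
  · rw [hg]; rw [← pow_mul, pow_succ']
  · rw [hT, hAe, add_pow_char_pow, mul_pow, C_pow, pow_succ' p s, pow_mul A₁]; ring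
  · intro j hj
    rcases coeff_add_ne hj with h1 | h1
    · exact hT0 j h1
    · rw [coeff_C_mul, coeff_X_pow] at h1
      split_ifs at h1 with h2
      · exact ⟨s, h2⟩
      · simp at h1
  · have : C τ₁ * (X ^ Q₁ * g₁ + C τ₁⁻¹ * Y) = C τ₁ * X ^ Q₁ * g₁ + (C τ₁ * C τ₁⁻¹) * Y := by ring
    rw [this, ← C_mul, mul_inv_cancel₀ hτ₁, C_1, hY]; ring
  · have h1 : p * (C τ₁⁻¹ * Y).natDegree ≤ (Y ^ p).natDegree := by
      rw [natDegree_pow]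
      exact Nat.mul_le_mul_left _ (natDegree_C_mul_le _ _)
    refine h1.trans ?_
    rw [hYp]
    refine (natDegree_sub_le _ _).trans (max_le ?_ ?_)
    · refine (natDegree_C_mul_le _ _).trans ((Nat.le_mul_of_pos_left _ hp.pos).trans hβ)
    · exact natDegree_C_mul_le _ _

lemma final1 {F : Type*} [Field F] [Finite F] (p n : ℕ) [Fact p.Prime] [CharP F p]
    (f T : F[X]) (t : F) (hd : 0 < f.natDegree) (hf' : derivative f ≠ 0)
    (hTf : T.comp f = - C t * (X ^ p ^ n - X) * derivative f)
    (hroot : ∀ γ, T.eval γ = 0 → ∃ α, f.eval α = γ ∧ (derivative f).eval α ≠ 0)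
    (hn : 1 ≤ n) (hTd : T.natDegree ≤ p ^ n) (h : Lev1 p (p ^ n) f T 1) :
    ∀ j, j ≠ 0 → T.coeff j ≠ 0 → ∃ i, j = p ^ i := by
  have hp := (Fact.out : p.Prime)
  have key : ∀ s, 1 ≤ s → s ≤ n → Lev1 p (p ^ n) f T s ∨ (∀ j, j ≠ 0 → T.coeff j ≠ 0 → ∃ i, j = p ^ i) := by
    intro s hs
    induction s, hs using Nat.le_induction with
    | base => intro _; exact Or.inl h
    | succ s hs ih =>
      intro hsn
      rcases ih (by omega) with h1 | h1
      · exact step1 p _ f T t hd hf' hTf hroot s hs (pow_dvd_pow _ hsn) h1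
      · exact Or.inr h1
  rcases key n hn le_rfl with h1 | h1
  · obtain ⟨g, T0, A, β, τ, Q, hPQ, hg, hT, hT0, hA, hτ, hβ⟩ := h1
    intro j hj hc
    have hjd := (le_natDegree_of_ne_zero hc).trans hTd
    rw [hT] at hc
    rcases coeff_add_ne hc with h1 | h1
    · exact hT0 j h1
    · obtain ⟨l, rfl, hl⟩ := coeff_pow_p p A n j h1
      have h2 : l ≠ 0 := by rintro rfl; simp at hj
      have hpn := pow_pos hp.pos n
      have h3 : l ≤ 1 := by
        by_contra h4
        have : p ^ n * 2 ≤ p ^ n * l := Nat.mul_le_mul_left _ (by omega)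
        omega
      exact ⟨n, by rw [show l = 1 by omega, mul_one]⟩
  · exact h1
end MV

namespace MV

lemma deriv_delta {F : Type*} [Field F] (p n : ℕ) [CharP F p] (hn : 1 ≤ n) :
    derivative (X ^ p ^ n - X : F[X]) = -1 := by
  have : ((p ^ n : ℕ) : F) = 0 := (cast_zero p _).2 (dvd_pow_self p (by omega))
  rw [derivative_sub, derivative_X_pow, derivative_X, this]; simp

lemma delta_ne {F : Type*} [Field F] (p n : ℕ) [CharP F p] (hn : 1 ≤ n) :
    (X ^ p ^ n - X : F[X]) ≠ 0 := by
  intro h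
  have := deriv_delta (F := F) p n hn
  rw [h] at this; simp at this

lemma base1 {F : Type*} [Field F] [Finite F] (p n : ℕ) [Fact p.Prime] [CharP F p]
    (f T : F[X]) (t : F) (ht : t ≠ 0)
    (hTf : T.comp f = - C t * (X ^ p ^ n - X) * derivative f)
    (hn : 1 ≤ n) (hT : derivative T = C t) : Lev1 p (p ^ n) f T 1 := by
  have hp := (Fact.out : p.Prime)
  have hD := deriv_delta (F := F) p n hn
  obtain ⟨A, hA⟩ := exists_pow p (T - C t * X) (by simp [hT])
  have hTe : T = C t * X + A ^ p := by rw [← hA]; ring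
  have hAf : (A.comp f) ^ p = - C t * (f + (X ^ p ^ n - X) * derivative f) := by
    have : A.comp f ^ p = (A ^ p).comp f := by simp
    rw [this, ← hA, sub_comp, hTf]; simp; ring
  have hf2 : derivative (derivative f) = 0 := by
    have h1 := congrArg derivative hAf
    rw [deriv_pow_p, ← C_neg, derivative_C_mul, derivative_add, derivative_mul, hD] at h1
    have h2 : C (-t) * ((X ^ p ^ n - X) * derivative (derivative f)) = 0 := by
      rw [h1]; ring
    have h3 := (mul_eq_zero.1 h2).resolve_left (by simpa using ht)
    exact (mul_eq_zero.1 h3).resolve_left (delta_ne p n hn)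
  obtain ⟨g, hg⟩ := exists_pow p _ hf2
  obtain ⟨β, hβ⟩ := exists_pow p (f - X * derivative f) (by
    simp [derivative_mul, hf2])
  obtain ⟨τ, hτ⟩ := const_root p (-t)
  refine ⟨g, C t * X, A, β, τ, p ^ (n-1), ?_, by rw [hg, pow_one], by rw [hTe, pow_one], ?_, ?_, ?_, ?_⟩
  · rw [← pow_add]; congr 1; omega
  · intro j hj
    rw [coeff_C_mul, coeff_X] at hj
    refine ⟨0, ?_⟩
    by_contra hc
    rw [if_neg (by simpa using Ne.symm hc)] at hj
    simp at hj
  · apply frobenius_inj F[X] p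
    simp only [frobenius_def]
    rw [hAf, mul_pow, add_pow_char, ← C_pow, ← hτ, mul_pow, ← hg, ← hβ, ← pow_mul, ← pow_succ,
      show n - 1 + 1 = n by omega, C_neg]
    ring
  · rintro rfl
    rw [zero_pow hp.ne_zero] at hτ
    exact ht (neg_eq_zero.1 hτ)
  · rw [← natDegree_pow, ← hβ]
    refine (natDegree_sub_le _ _).trans (max_le le_rfl ?_)
    by_cases h0 : derivative f = 0
    · simp [h0]
    rw [natDegree_X_mul h0]
    have h1 := natDegree_derivative_le f
    by_cases h2 : f.natDegree = 0
    · exact absurd (derivative_of_natDegree_zero h2) h0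
    · omega
end MV

namespace MV

lemma step2_alg {F : Type*} [Field F] (p v : ℕ) [Fact p.Prime] [CharP F p] (hv : 2 ≤ v)
    (f L : F[X]) (α : F) (hL : 0 < L.natDegree) (hα : L.eval α = 0)
    (hcop : IsCoprime (derivative L) f)
    (s : ℕ) (hs : 1 ≤ s) (M G E B : F[X]) (τ : F) (Q i0 j1 w : ℕ)
    (hf : f = L ^ v * M ^ p ^ s) (hG : derivative L = G ^ p ^ s)
    (hij : v * j1 + 1 = p ^ s * i0)
    (hI : L ^ i0 * M ^ j1 * E.comp f = C τ * (X ^ Q * G + B)) (hQ : p ∣ Q)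
    (hB : p * B.natDegree ≤ L.natDegree + w * M.natDegree) (hw : w * v ≤ p ^ s)
    (hM : M.eval α ≠ 0) (l : ℕ) (hl : E.coeff l ≠ 0) (hl1 : 1 ≤ l ∨ 2 ≤ i0) :
    p ∣ i0 + v * l ∧ derivative M = 0 ∧ derivative G = 0 := by
  have hp := (Fact.out : p.Prime)
  set P := p ^ s with hP
  have hP2 : 2 ≤ P := hp.two_le.trans (Nat.le_self_pow (by omega) p)
  have hpP : p ∣ P := dvd_pow_self p (by omega)
  have hL0 : L ≠ 0 := by rintro rfl; simp at hL
  have hM0 : M ≠ 0 := by rintro rfl; simp at hM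
  have hf0 : f ≠ 0 := by rw [hf]; exact mul_ne_zero (pow_ne_zero _ hL0) (pow_ne_zero _ hM0)
  have hi0 : 1 ≤ i0 := by
    rcases Nat.eq_zero_or_pos i0 with h | h
    · rw [h] at hij; omega
    · exact h
  have hj1 : 1 ≤ j1 := by
    rcases Nat.eq_zero_or_pos j1 with h | h
    · rw [h] at hij
      have := Nat.mul_le_mul hP2 hi0
      omega
    · exact h
  have hj1F : (j1 : F) ≠ 0 := by
    intro h
    have h1 := (cast_zero p j1).1 h
    have h2 : p ∣ 1 := (Nat.dvd_add_right (h1.mul_left v)).1 (hij ▸ hpP.mul_right i0)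
    exact hp.one_lt.ne' (Nat.dvd_one.1 h2)
  have hQ0 : (Q : F) = 0 := (cast_zero p Q).2 hQ
  have hPF : (P : F) = 0 := (cast_zero p P).2 hpP
  have hX : derivative ((X : F[X]) ^ Q) = 0 := by
    rw [derivative_X_pow, hQ0]; simp
  -- degrees
  have hfd : f.natDegree = v * L.natDegree + P * M.natDegree := by
    rw [hf, natDegree_mul (pow_ne_zero _ hL0) (pow_ne_zero _ hM0), natDegree_pow, natDegree_pow]
  have hGd : P * G.natDegree ≤ L.natDegree - 1 := by
    rw [← natDegree_pow, ← hG]; exact natDegree_derivative_le L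
  have h2G : 2 * G.natDegree ≤ P * G.natDegree := Nat.mul_le_mul_right _ hP2
  have h2B : 2 * B.natDegree ≤ p * B.natDegree := Nat.mul_le_mul_right _ hp.two_le
  have h2L : 2 * L.natDegree ≤ v * L.natDegree := Nat.mul_le_mul_right _ hv
  have h2M : 2 * M.natDegree ≤ P * M.natDegree := Nat.mul_le_mul_right _ hP2
  have hwP : 2 * (w * M.natDegree) ≤ P * M.natDegree := by
    have : w * 2 ≤ P := (Nat.mul_le_mul_left w hv).trans hw
    calc 2 * (w * M.natDegree) = (w * 2) * M.natDegree := by ring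
      _ ≤ _ := Nat.mul_le_mul_right _ this
  -- the derivative identity
  have hMP : derivative (M ^ P) = 0 := by rw [derivative_pow, hPF]; simp
  have hf' : L * derivative f = C (v : F) * derivative L * f := by
    rw [hf, derivative_mul, hMP, mul_zero, add_zero, derivative_pow]
    obtain ⟨u, rfl⟩ : ∃ u, v = u + 1 := ⟨v - 1, by omega⟩
    simp only [Nat.add_sub_cancel]
    rw [pow_succ]; ring
  obtain ⟨i, rfl⟩ : ∃ i, i0 = i + 1 := ⟨i0 - 1, by omega⟩
  obtain ⟨j, rfl⟩ : ∃ j, j1 = j + 1 := ⟨j1 - 1, by omega⟩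
  have hder := congrArg derivative hI
  rw [derivative_mul, derivative_mul, derivative_comp, derivative_C_mul, derivative_add,
    derivative_mul, hX, zero_mul, zero_add, derivative_pow, derivative_pow] at hder
  simp only [Nat.add_sub_cancel] at hder
  set H := L ^ i * M ^ j with hH
  have hH0 : H ≠ 0 := mul_ne_zero (pow_ne_zero _ hL0) (pow_ne_zero _ hM0)
  set k := C τ * (derivative B * G - B * derivative G) with hk
  set G2 := C ((j + 1 : ℕ) : F) * derivative M * G - M * derivative G with hG2
  have hid : H * (E.comp f * (C ((i+1 : ℕ) : F) * G ^ (P + 1) * M + L * G2) +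
      (X * derivative E).comp f * (C (v : F) * G ^ (P+1) * M)) = k := by
    rw [hk, hH, hG2, mul_comp, X_comp, pow_succ, ← hG]
    have e1 : L ^ (i+1) = L ^ i * L := pow_succ _ _
    have e2 : M ^ (j+1) = M ^ j * M := pow_succ _ _
    rw [e1, e2] at hder hI
    linear_combination G * hder - derivative G * hI - L ^ i * M ^ j * M * (derivative E).comp f * G * hf'
  have hkd : 2 * k.natDegree ≤ 2 * L.natDegree - 1 + w * M.natDegree := by
    have h1 : k.natDegree ≤ B.natDegree + G.natDegree := by
      refine (natDegree_C_mul_le _ _).trans ?_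
      refine (natDegree_sub_le _ _).trans (max_le ?_ ?_)
      · refine natDegree_mul_le.trans ?_
        have := natDegree_derivative_le B; omega
      · refine natDegree_mul_le.trans ?_
        have := natDegree_derivative_le G; omega
    omega
  set N := E.natDegree + 2 with hN
  set c : ℕ → F[X] := fun l => C (((i + 1 + v * l : ℕ) : F)) * G ^ (P+1) * M + L * G2 with hc
  set Sg := ∑ l ∈ Finset.range N, (C (E.coeff l) * c l) * f ^ l with hSg
  have hsum : H * Sg = k := by
    rw [← hid]
    congr 1
    have e1 : (X * derivative E).comp f = ∑ i ∈ Finset.range N, C ((i:F) * E.coeff i) * f ^ i := by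
      rw [comp_sum _ f N]
      · refine Finset.sum_congr rfl fun i _ => ?_
        rcases i with _ | i
        · simp
        · rw [coeff_X_mul, coeff_derivative]; push_cast; ring_nf
      · refine lt_of_le_of_lt natDegree_mul_le ?_
        have := natDegree_derivative_le E
        rw [natDegree_X]
        omega
    have e3 := comp_sum E f N (by omega)
    rw [hSg, e1, e3, Finset.sum_mul, Finset.sum_mul, ← Finset.sum_add_distrib]
    refine Finset.sum_congr rfl fun l _ => ?_
    simp only [hc]
    push_cast
    simp only [C_add, C_mul, C_1]
    ring
  have hcd : ∀ l, (C (E.coeff l) * c l).degree < f.degree := by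
    intro l
    apply deg_lt_of_nat
    refine lt_of_le_of_lt (natDegree_C_mul_le _ _) ?_
    have h1 : (C (((i + 1 + v * l : ℕ) : F)) * G ^ (P+1) * M).natDegree ≤
        P * G.natDegree + G.natDegree + M.natDegree := by
      refine natDegree_mul_le.trans ?_
      have h2 := natDegree_C_mul_le (((i + 1 + v * l : ℕ) : F)) (G ^ (P+1))
      rw [natDegree_pow] at h2
      have h3 : (P + 1) * G.natDegree = P * G.natDegree + G.natDegree := by ring
      omega
    have h2 : (L * G2).natDegree ≤ L.natDegree + M.natDegree + G.natDegree := by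
      refine natDegree_mul_le.trans ?_
      have : G2.natDegree ≤ M.natDegree + G.natDegree := by
        refine (natDegree_sub_le _ _).trans (max_le ?_ ?_)
        · refine natDegree_mul_le.trans ?_
          have h2 := natDegree_C_mul_le (((j + 1 : ℕ) : F)) (derivative M)
          have := natDegree_derivative_le M; omega
        · refine natDegree_mul_le.trans ?_
          have := natDegree_derivative_le G; omega
      omega
    have h3 := natDegree_add_le (C (((i + 1 + v * l : ℕ) : F)) * G ^ (P+1) * M) (L * G2)
    have h4 : (c l).natDegree ≤ max (P * G.natDegree + G.natDegree + M.natDegree)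
      (L.natDegree + M.natDegree + G.natDegree) := h3.trans (max_le_max h1 h2)
    omega
  have hSd : Sg.degree < f.degree := by
    by_cases hS0 : Sg = 0
    · rw [hS0, degree_zero]; exact bot_lt_iff_ne_bot.2 (by simpa using hf0)
    apply deg_lt_of_nat
    have : k.natDegree = H.natDegree + Sg.natDegree := by
      rw [← hsum, natDegree_mul hH0 hS0]
    omega
  have hdec := decouple f N _ Sg hSd hcd rfl
  have hlN : l < N := by
    have := le_natDegree_of_ne_zero hl; omega
  have hcl : c l = 0 := by
    have h1 : C (E.coeff l) * c l = 0 := by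
      have h2 := hdec l hlN
      by_cases hl0 : l = 0
      · rw [if_pos hl0] at h2
        rw [h2]
        by_contra hS0
        have h3 : k.natDegree = H.natDegree + Sg.natDegree := by
          rw [← hsum, natDegree_mul hH0 hS0]
        rw [hH, natDegree_mul (pow_ne_zero _ hL0) (pow_ne_zero _ hM0), natDegree_pow, natDegree_pow] at h3
        have hi1 : 1 ≤ i := by omega
        have h4 : 1 * L.natDegree ≤ i * L.natDegree := Nat.mul_le_mul_right _ hi1
        have h5 : w ≤ 2 * j := by
          rcases Nat.eq_zero_or_pos w with hw0 | hw0
          · omega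
          · have e1 : 1 * v ≤ w * v := Nat.mul_le_mul_right _ hw0
            have e2 : P * 2 ≤ P * (i + 1) := Nat.mul_le_mul_left _ (by omega)
            have e3 : v * (j + 1) = v * j + v := by ring
            have e4 : v * w ≤ v * (2 * j) := by
              have e5 : v * (2 * j) = 2 * (v * j) := by ring
              rw [e5, mul_comm v w]; omega
            exact Nat.le_of_mul_le_mul_left e4 (by omega)
        have h6 : w * M.natDegree ≤ 2 * (j * M.natDegree) := by
          rw [← mul_assoc]; exact Nat.mul_le_mul_right _ h5
        omega
      · rwa [if_neg hl0] at h2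
    exact (mul_eq_zero.1 h1).resolve_left (by simpa using hl)
  have hfα : f.eval α = 0 := by
    rw [hf, eval_mul, eval_pow, hα, zero_pow (by omega), zero_mul]
  have hGα : G.eval α ≠ 0 := by
    intro h
    obtain ⟨x, y, hxy⟩ := hcop
    have := congrArg (eval α) hxy
    rw [hG] at this
    simp [hfα, h, show P ≠ 0 by omega] at this
  have hz : ((i + 1 + v * l : ℕ) : F) = 0 := by
    have := congrArg (eval α) hcl
    simp only [hc, eval_add, eval_mul, eval_C, eval_pow, hα, zero_mul, add_zero, eval_zero] at this
    exact (mul_eq_zero.1 ((mul_eq_zero.1 this).resolve_right hM)).resolve_right (pow_ne_zero _ hGα)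
  have hG20 : G2 = 0 := by
    simp only [hc, hz, C_0, zero_mul, zero_add] at hcl
    exact (mul_eq_zero.1 hcl).resolve_left hL0
  have hGM : IsCoprime M G := by
    rw [hG, hf] at hcop
    have h1 := hcop.of_mul_right_right
    have h2 := (IsCoprime.pow_iff (by omega : 0 < P) (by omega : 0 < P)).1 h1
    exact h2.symm
  have hMM : M ∣ derivative M := by
    have h1 : M ∣ (C ((j + 1 : ℕ) : F) * derivative M) * G := ⟨derivative G, by
      rw [hG2] at hG20; exact sub_eq_zero.1 hG20⟩
    have h2 := hGM.dvd_of_dvd_mul_right h1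
    exact (dvd_C_mul hj1F).1 h2
  have hM' : derivative M = 0 := by
    by_contra hne
    have h1 := natDegree_le_of_dvd hMM hne
    have h2 : M.natDegree ≠ 0 := fun h => hne (derivative_of_natDegree_zero h)
    exact absurd (natDegree_derivative_lt h2) (by omega)
  refine ⟨(cast_zero (F := F) p _).1 hz, hM', ?_⟩
  rw [hG2, hM', mul_zero, zero_mul, zero_sub, neg_eq_zero] at hG20
  exact (mul_eq_zero.1 hG20).resolve_left hM0
end MV

namespace MV

/-- Admissible exponents. -/
def Adm (p v j : ℕ) : Prop := ∃ j' i, j = j' + 1 ∧ v * j' + 1 = p ^ i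

/-- Level data in the ramified case. -/
def Lev2 {F : Type*} [Field F] (p q v : ℕ) (f T L : F[X]) (α : F) (s : ℕ) : Prop :=
  ∃ (M G T0 E B : F[X]) (τ : F) (Q i0 j1 w : ℕ), p ^ s * Q = q ∧
    f = L ^ v * M ^ p ^ s ∧ derivative L = G ^ p ^ s ∧
    T = T0 + X ^ (j1 + 1) * E ^ p ^ s ∧ (∀ j, T0.coeff j ≠ 0 → Adm p v j) ∧
    v * j1 + 1 = p ^ s * i0 ∧
    L ^ i0 * M ^ j1 * E.comp f = C τ * (X ^ Q * G + B) ∧ τ ≠ 0 ∧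
    p * B.natDegree ≤ L.natDegree + w * M.natDegree ∧ w * v ≤ p ^ s ∧ M.eval α ≠ 0

lemma coeff_X_mul_pow {F : Type*} [Field F] (p : ℕ) [Fact p.Prime] [CharP F p] (E : F[X])
    (s m j : ℕ) (h : (X ^ m * E ^ p ^ s).coeff j ≠ 0) :
    ∃ l, j = m + p ^ s * l ∧ E.coeff l ≠ 0 := by
  rw [coeff_X_pow_mul'] at h
  split_ifs at h with hm
  · obtain ⟨l, h1, h2⟩ := coeff_pow_p p E s _ h
    exact ⟨l, by omega, h2⟩
  · simp at h

lemma step2 {F : Type*} [Field F] [Finite F] (p q v : ℕ) [Fact p.Prime] [CharP F p] (hv : 2 ≤ v)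
    (f T L : F[X]) (α : F) (hL : 0 < L.natDegree) (hα : L.eval α = 0)
    (hcop : IsCoprime (derivative L) f)
    (s : ℕ) (hs : 1 ≤ s) (hsq : p ^ (s+1) ∣ q) (h : Lev2 p q v f T L α s) :
    Lev2 p q v f T L α (s+1) ∨ (∀ j, T.coeff j ≠ 0 → Adm p v j) := by
  have hp := (Fact.out : p.Prime)
  obtain ⟨M, G, T0, E, B, τ, Q, i0, j1, w, hPQ, hf, hG, hT, hT0, hij, hI, hτ, hB, hw, hM⟩ := h
  have hQ : p ∣ Q := by
    rw [← hPQ, pow_succ] at hsq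
    exact Nat.dvd_of_mul_dvd_mul_left (pow_pos hp.pos s) hsq
  have hi0 : 1 ≤ i0 := by
    rcases Nat.eq_zero_or_pos i0 with h | h
    · rw [h] at hij; omega
    · exact h
  have halg := step2_alg p v hv f L α hL hα hcop s hs M G E B τ Q i0 j1 w hf hG hij hI hQ hB hw hM
  by_cases hex : ∃ l, E.coeff l ≠ 0 ∧ (1 ≤ l ∨ 2 ≤ i0)
  swap
  · right
    intro j hc
    push Not at hex
    rw [hT] at hc
    rcases coeff_add_ne hc with h1 | h1
    · exact hT0 j h1
    · obtain ⟨l, rfl, hl⟩ := coeff_X_mul_pow p E s _ j h1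
      have h2 := hex l hl
      have h3 : l = 0 := by omega
      have h4 : i0 = 1 := by omega
      refine ⟨j1, s, by rw [h3]; ring, by rw [hij, h4, mul_one]⟩
  left
  obtain ⟨ls, hls, hls1⟩ := hex
  obtain ⟨hdv, hM', hG'⟩ := halg ls hls hls1
  have hpv : ¬ p ∣ v := by
    intro h1
    have hpP : p ∣ p ^ s := dvd_pow_self p (by omega)
    have h2 : p ∣ 1 := (Nat.dvd_add_right (h1.mul_right j1)).1 (hij ▸ hpP.mul_right i0)
    exact hp.one_lt.ne' (Nat.dvd_one.1 h2)
  obtain ⟨M₁, rfl⟩ := exists_pow p M hM'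
  obtain ⟨G₁, rfl⟩ := exists_pow p G hG'
  set ρ := ls % p with hρ
  have hmod : ∀ l, E.coeff l ≠ 0 → (1 ≤ l ∨ 2 ≤ i0) → l % p = ρ := by
    intro l h1 h2
    have h3 := (halg l h1 h2).1
    have h4 : i0 + v * l ≡ i0 + v * ls [MOD p] :=
      ((Nat.modEq_zero_iff_dvd).2 h3).trans ((Nat.modEq_zero_iff_dvd).2 hdv).symm
    have h5 := Nat.ModEq.add_left_cancel' i0 h4
    have hcp : Nat.gcd p v = 1 := (Nat.Prime.coprime_iff_not_dvd hp).2 hpv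
    exact Nat.ModEq.cancel_left_of_coprime hcp h5
  set e0 : F := if i0 = 1 then E.coeff 0 else 0 with he0
  obtain ⟨E₁, hE₁⟩ := exists_X_pow p (E - C e0) ρ (Nat.mod_lt _ hp.pos) (by
    intro l hl
    rw [coeff_sub, coeff_C] at hl
    rcases Nat.eq_zero_or_pos l with h0 | h0
    · subst h0
      by_cases h1 : i0 = 1
      · simp [he0, h1] at hl
      · simp only [he0, if_neg h1] at hl
        exact hmod 0 (by simpa using hl) (by omega)
    · rw [if_neg (by omega), sub_zero] at hl
      exact hmod l hl (Or.inl h0))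
  have hEe : E = C e0 + X ^ ρ * E₁ ^ p := by rw [← hE₁]; ring
  obtain ⟨i1, hi1⟩ : p ∣ i0 + v * ρ := by
    have h1 : i0 + v * ρ ≡ i0 + v * ls [MOD p] :=
      Nat.ModEq.add_left _ (Nat.ModEq.mul_left _ (Nat.mod_modEq ls p))
    exact (Nat.modEq_zero_iff_dvd).1 (h1.trans ((Nat.modEq_zero_iff_dvd).2 hdv))
  obtain ⟨τ₁, rfl⟩ := const_root p τ
  obtain ⟨Q₁, rfl⟩ := hQ
  have hτ₁ : τ₁ ≠ 0 := by rintro rfl; exact hτ (zero_pow hp.ne_zero)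
  set P := p ^ s with hP
  set Y := L ^ i1 * M₁ ^ (j1 + P * ρ) * E₁.comp f - C τ₁ * X ^ Q₁ * G₁ with hY
  have hfρ : f ^ ρ = L ^ (v * ρ) * (M₁ ^ p) ^ (P * ρ) := by
    nth_rewrite 1 [hf]
    rw [mul_pow, ← pow_mul, ← pow_mul]
  have hYp : Y ^ p = C (τ₁ ^ p) * B - L ^ i0 * (M₁ ^ p) ^ j1 * C e0 := by
    rw [hY, sub_pow_char]
    rw [hEe] at hI
    simp only [add_comp, mul_comp, C_comp, X_comp, pow_comp] at hI
    rw [hfρ] at hI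
    have e1 : (L ^ i1 * M₁ ^ (j1 + P * ρ) * E₁.comp f) ^ p
        = L ^ i0 * (M₁ ^ p) ^ j1 * (L ^ (v * ρ) * (M₁ ^ p) ^ (P * ρ) * (E₁.comp f) ^ p) := by
      rw [mul_pow, mul_pow, ← pow_mul, mul_comm i1 p, ← hi1]
      ring
    rw [e1, mul_pow, mul_pow, ← C_pow, ← pow_mul X Q₁ p, mul_comm Q₁ p]
    linear_combination hI
  have hP0 : P ≠ 0 := (pow_pos hp.pos s).ne'
  refine ⟨M₁, G₁, T0 + C (e0 ^ P) * X ^ (j1 + 1), E₁, C τ₁⁻¹ * Y, τ₁, Q₁, i1, j1 + P * ρ,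
    p * (if i0 = 1 then j1 else w), ?_, ?_, ?_, ?_, ?_, ?_, ?_, hτ₁, ?_, ?_, ?_⟩
  · rw [← hPQ]; ring
  · rw [hf]; rw [← pow_mul, ← pow_succ']
  · rw [hG]; rw [← pow_mul, ← pow_succ']
  · rw [hT, hEe, hP, add_pow_char_pow, mul_pow, C_pow, pow_succ' p s, pow_mul E₁, ← hP]; ring
  · intro j hj
    rcases coeff_add_ne hj with h1 | h1
    · exact hT0 j h1
    · rw [coeff_C_mul, coeff_X_pow] at h1
      split_ifs at h1 with h2
      · by_cases h3 : i0 = 1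
        · exact ⟨j1, s, h2, by rw [hij, h3, mul_one]⟩
        · simp [he0, h3, hP0] at h1
      · simp at h1
  · have : v * (j1 + P * ρ) + 1 = (v * j1 + 1) + P * (v * ρ) := by ring
    rw [this, hij, ← mul_add, hi1, hP, pow_succ]; ring
  · have : C τ₁ * (X ^ Q₁ * G₁ + C τ₁⁻¹ * Y) = C τ₁ * X ^ Q₁ * G₁ + (C τ₁ * C τ₁⁻¹) * Y := by ring
    rw [this, ← C_mul, mul_inv_cancel₀ hτ₁, C_1, hY]; ring
  · have h1 : p * (C τ₁⁻¹ * Y).natDegree ≤ (Y ^ p).natDegree := by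
      rw [natDegree_pow]
      exact Nat.mul_le_mul_left _ (natDegree_C_mul_le _ _)
    refine h1.trans ?_
    rw [natDegree_pow] at hB
    have hBB : B.natDegree ≤ p * B.natDegree := Nat.le_mul_of_pos_left _ hp.pos
    rw [hYp]
    refine (natDegree_sub_le _ _).trans (max_le ?_ ?_)
    · refine (natDegree_C_mul_le _ _).trans ((hBB.trans hB).trans ?_)
      have h2 : w ≤ if i0 = 1 then j1 else w := by
        split_ifs with h3
        · rw [h3] at hij
          by_contra h4
          have e1 : (j1 + 1) * v ≤ w * v := Nat.mul_le_mul_right _ (by omega)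
          have e2 : (j1 + 1) * v = v * j1 + v := by ring
          omega
        · exact le_rfl
      have h3 := Nat.mul_le_mul_right (p * M₁.natDegree) h2
      calc L.natDegree + w * (p * M₁.natDegree) ≤ L.natDegree + _ := Nat.add_le_add_left h3 _
        _ = _ := by ring
    · by_cases h3 : i0 = 1
      · rw [if_pos h3, h3]
        refine natDegree_mul_le.trans ?_
        rw [natDegree_C, add_zero]
        refine natDegree_mul_le.trans ?_
        rw [pow_one, natDegree_pow, natDegree_pow]
        exact le_of_eq (by ring)
      · simp [he0, h3]
  · rw [pow_succ', mul_assoc]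
    refine Nat.mul_le_mul_left _ ?_
    split_ifs with h3
    · rw [h3] at hij; rw [← hP, mul_comm j1]; omega
    · exact hw
  · intro h0
    exact hM (by rw [eval_pow, h0, zero_pow hp.ne_zero])

lemma final2 {F : Type*} [Field F] [Finite F] (p n v : ℕ) [Fact p.Prime] [CharP F p] (hv : 2 ≤ v)
    (f T L : F[X]) (α : F) (hL : 0 < L.natDegree) (hα : L.eval α = 0)
    (hcop : IsCoprime (derivative L) f)
    (hn : 1 ≤ n) (hTd : ∀ j, T.coeff j ≠ 0 → v * (j - 1) + 1 ≤ p ^ n)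
    (h : Lev2 p (p ^ n) v f T L α 1) :
    ∀ j, T.coeff j ≠ 0 → Adm p v j := by
  have hp := (Fact.out : p.Prime)
  have key : ∀ s, 1 ≤ s → s ≤ n → Lev2 p (p ^ n) v f T L α s ∨ (∀ j, T.coeff j ≠ 0 → Adm p v j) := by
    intro s hs
    induction s, hs using Nat.le_induction with
    | base => intro _; exact Or.inl h
    | succ s hs ih =>
      intro hsn
      rcases ih (by omega) with h1 | h1
      · exact step2 p _ v hv f T L α hL hα hcop s hs (pow_dvd_pow _ hsn) h1
      · exact Or.inr h1
  rcases key n hn le_rfl with h1 | h1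
  · obtain ⟨M, G, T0, E, B, τ, Q, i0, j1, w, hPQ, hf, hG, hT, hT0, hij, hI, hτ, hB, hw, hM⟩ := h1
    intro j hc
    have hjd := hTd j hc
    rw [hT] at hc
    rcases coeff_add_ne hc with h1 | h1
    · exact hT0 j h1
    · obtain ⟨l, rfl, hl⟩ := coeff_X_mul_pow p E n _ j h1
      have hpn := pow_pos hp.pos n
      have e1 : v * (j1 + 1 + p ^ n * l - 1) + 1 = p ^ n * (i0 + v * l) := by
        rw [show j1 + 1 + p ^ n * l - 1 = j1 + p ^ n * l by omega, mul_add (p ^ n) i0, ← hij]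
        ring
      rw [e1] at hjd
      have h3 : i0 + v * l ≤ 1 := by
        by_contra h4
        have : p ^ n * 2 ≤ p ^ n * (i0 + v * l) := Nat.mul_le_mul_left _ (by omega)
        omega
      have h5 : i0 + v * l ≠ 0 := by
        intro h0; rw [h0] at e1; omega
      have h6 : i0 + v * l = 1 := by omega
      refine ⟨j1 + p ^ n * l, n, by omega, ?_⟩
      rw [h6, mul_one] at e1
      rwa [show j1 + 1 + p ^ n * l - 1 = j1 + p ^ n * l by omega] at e1
  · exact h1
end MV

namespace MV

lemma base2 {F : Type*} [Field F] [Finite F] (p n v r : ℕ) [Fact p.Prime] [CharP F p]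
    (hv : 2 ≤ v) (hn : 1 ≤ n)
    (f T₁ L Lh M₁ : F[X]) (α t : F) (ht : t ≠ 0) (hT1 : T₁.coeff 0 ≠ 0)
    (hTf : f * T₁.comp f = - C t * (X ^ p ^ n - X) * derivative f)
    (hT : X * derivative (X * T₁) - C t * X = C ((r : F) + 1) * (X * T₁))
    (hL : 0 < L.natDegree) (hδ : X ^ p ^ n - X = L * Lh) (hcop : IsCoprime Lh M₁)
    (hf : f = L ^ v * M₁) (hα : L.eval α = 0) (hM : M₁.eval α ≠ 0) :
    Lev2 p (p ^ n) v f (X * T₁) L α 1 ∧ IsCoprime (derivative L) f ∧ ((v * r + 1 : ℕ) : F) = 0 := by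
  have hp := (Fact.out : p.Prime)
  have hD := deriv_delta (F := F) p n hn
  have hL0 : L ≠ 0 := by rintro rfl; simp at hL
  have hM0 : M₁ ≠ 0 := by rintro rfl; simp at hM
  have hLL : derivative L * Lh + L * derivative Lh = -1 := by
    rw [← derivative_mul, ← hδ, hD]
  set τ₁ := T₁.coeff 0 with hτ₁
  have hdf : derivative f = C (v : F) * L ^ (v - 1) * derivative L * M₁ + L ^ v * derivative M₁ := by
    rw [hf, derivative_mul, derivative_pow]
  have hvL : L ^ v = L ^ (v - 1) * L := by rw [← pow_succ]; congr 1; omega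
  have h1 : M₁ * T₁.comp f = - C t * Lh * (C (v : F) * derivative L * M₁ + L * derivative M₁) := by
    have h2 : L ^ v * (M₁ * T₁.comp f) =
        L ^ v * (- C t * Lh * (C (v : F) * derivative L * M₁ + L * derivative M₁)) := by
      rw [← mul_assoc, ← hf, hTf, hδ, hdf, hvL]; ring
    exact mul_left_cancel₀ (pow_ne_zero _ hL0) h2
  have h2 : M₁ ∣ L * derivative M₁ := by
    have h3 : M₁ ∣ Lh * (C t * (L * derivative M₁)) :=
      ⟨- (T₁.comp f + C t * Lh * C (v:F) * derivative L), by linear_combination h1⟩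
    have h4 := hcop.symm.dvd_of_dvd_mul_left h3
    exact (dvd_C_mul ht).1 h4
  obtain ⟨W, hW⟩ := h2
  have h3 : T₁.comp f = - C t * Lh * (C (v : F) * derivative L + W) := by
    apply mul_left_cancel₀ hM0
    rw [h1, hW]; ring
  have hfL : L ∣ f := by rw [hf, hvL]; exact ⟨L ^ (v-1) * M₁, by ring⟩
  have hfc : f ∣ T₁.comp f - C τ₁ := by
    have e1 : X ∣ T₁ - C τ₁ := by rw [X_dvd_iff]; simp [hτ₁]
    obtain ⟨e, he⟩ := e1
    refine ⟨e.comp f, ?_⟩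
    have := congrArg (fun x => x.comp f) he
    simpa using this
  have h4 : L ∣ C t * W + C (t * v - τ₁) * derivative L := by
    obtain ⟨u, hu⟩ := hfL.trans hfc
    refine ⟨u * derivative L - C t * (C (v:F) * derivative L + W) * derivative Lh, ?_⟩
    rw [C_sub, C_mul]
    rw [h3] at hu
    linear_combination derivative L * hu + C t * (C (v:F) * derivative L + W) * hLL
  have hL'd : (derivative L).natDegree < L.natDegree := natDegree_derivative_lt (by omega)
  have hWd : W.natDegree < L.natDegree := by
    by_cases hW0 : W = 0
    · rw [hW0]; simpa using hL
    have hM1' : derivative M₁ ≠ 0 := by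
      intro h0; rw [h0, mul_zero] at hW
      exact (mul_ne_zero hM0 hW0) hW.symm
    have e1 := congrArg natDegree hW
    rw [natDegree_mul hL0 hM1', natDegree_mul hM0 hW0] at e1
    have : M₁.natDegree ≠ 0 := fun h => hM1' (derivative_of_natDegree_zero h)
    have := natDegree_derivative_lt this
    omega
  have h5 : C t * W + C (t * v - τ₁) * derivative L = 0 := by
    by_contra hne
    have e1 := natDegree_le_of_dvd h4 hne
    have e2 := natDegree_add_le (C t * W) (C (t * v - τ₁) * derivative L)
    have e3 := natDegree_C_mul_le t W
    have e4 := natDegree_C_mul_le (t * v - τ₁) (derivative L)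
    omega
  have hL'α : (derivative L).eval α ≠ 0 := by
    intro h0
    have := congrArg (eval α) hLL
    simp [h0, hα] at this
  have hν : t * v - τ₁ = 0 := by
    have e1 := congrArg (eval α) hW
    rw [eval_mul, eval_mul, hα, zero_mul] at e1
    have e2 := (mul_eq_zero.1 e1.symm).resolve_left hM
    have e3 := congrArg (eval α) h5
    rw [eval_add, eval_mul, eval_mul, eval_C, eval_C, e2, mul_zero, zero_add, eval_zero] at e3
    exact (mul_eq_zero.1 e3).resolve_right hL'α
  have hW0 : W = 0 := by
    rw [hν, C_0, zero_mul, add_zero] at h5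
    exact (mul_eq_zero.1 h5).resolve_left (by simpa using ht)
  have hM1' : derivative M₁ = 0 := by
    rw [hW0, mul_zero] at hW
    exact (mul_eq_zero.1 hW).resolve_left hL0
  obtain ⟨M, rfl⟩ := exists_pow p M₁ hM1'
  have htv : τ₁ = t * v := (sub_eq_zero.1 hν).symm
  have h6 : T₁.comp f = - C τ₁ * Lh * derivative L := by
    rw [h3, hW0, htv, C_mul]; ring
  have hcopL : IsCoprime (derivative L) f := by
    have e1 : IsCoprime (T₁.comp f) f := by
      obtain ⟨u, hu⟩ := hfc
      refine ⟨C τ₁⁻¹, - C τ₁⁻¹ * u, ?_⟩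
      have : (1 : F[X]) = C τ₁⁻¹ * C τ₁ := by rw [← C_mul, inv_mul_cancel₀ hT1, C_1]
      rw [this]; linear_combination C τ₁⁻¹ * hu
    exact e1.of_isCoprime_of_dvd_left ⟨- C τ₁ * Lh, by rw [h6]; ring⟩
  -- coefficients
  have hco : ∀ l : ℕ, ((l : F) + 1) * T₁.coeff l - (if l = 0 then t else 0) = ((r:F) + 1) * T₁.coeff l := by
    intro l
    have := congrArg (fun g => coeff g (l+1)) hT
    simp only [coeff_sub, coeff_X_mul, coeff_derivative, coeff_C_mul] at this
    rw [← this, coeff_X]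
    by_cases hl : l = 0
    · simp [hl]
    · simp [hl]; ring
  have htr : t = - (r : F) * τ₁ := by
    have := hco 0
    simp at this
    rw [← hτ₁] at this
    linear_combination -this
  have hvr : ((v * r + 1 : ℕ) : F) = 0 := by
    push_cast
    have : ((v : F) * r + 1) * τ₁ = 0 := by
      rw [htr] at htv
      linear_combination htv
    exact (mul_eq_zero.1 this).resolve_right hT1
  obtain ⟨E, hE⟩ := exists_X_pow p (T₁ - C τ₁) (r % p) (Nat.mod_lt _ hp.pos) (by
    intro l hl
    rw [coeff_sub, coeff_C] at hl
    by_cases h0 : l = 0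
    · simp [h0, hτ₁] at hl
    · rw [if_neg h0, sub_zero] at hl
      have := hco l
      rw [if_neg h0, sub_zero] at this
      have e1 := mul_right_cancel₀ hl this
      have e2 : (l : F) = r := by linear_combination e1
      exact (CharP.natCast_eq_natCast F p).1 e2)
  have hTe : T₁ = C τ₁ + X ^ (r % p) * E ^ p := by rw [← hE]; ring
  obtain ⟨i0, hi0⟩ : p ∣ v * (r % p) + 1 := by
    have e1 : v * (r % p) + 1 ≡ v * r + 1 [MOD p] :=
      Nat.ModEq.add_right _ (Nat.ModEq.mul_left _ (Nat.mod_modEq r p))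
    exact (Nat.modEq_zero_iff_dvd).1 (e1.trans ((Nat.modEq_zero_iff_dvd).2 ((cast_zero (F:=F) p _).1 hvr)))
  set j1 := r % p with hj1
  have hpow : (L ^ i0 * M ^ j1 * E.comp f) ^ p = - C τ₁ * (L + (X ^ p ^ n - X) * derivative L) := by
    have e1 : (L ^ i0 * M ^ j1 * E.comp f) ^ p = L * (f ^ j1 * (E.comp f) ^ p) := by
      nth_rewrite 2 [hf]
      rw [mul_pow, mul_pow, ← pow_mul L i0 p, mul_comm i0 p, ← hi0]
      ring
    have e2 : f ^ j1 * (E.comp f) ^ p = T₁.comp f - C τ₁ := by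
      have := congrArg (fun x => x.comp f) hE
      simpa using this.symm
    rw [e1, e2, h6, hδ]; ring
  have hL2 : derivative (derivative L) = 0 := by
    have h1 := congrArg derivative hpow
    rw [deriv_pow_p, ← C_neg, derivative_C_mul, derivative_add, derivative_mul, hD] at h1
    have h2 : C (-τ₁) * ((X ^ p ^ n - X) * derivative (derivative L)) = 0 := by
      rw [h1]; ring
    have h3 := (mul_eq_zero.1 h2).resolve_left (by simpa using hT1)
    exact (mul_eq_zero.1 h3).resolve_left (delta_ne p n hn)
  obtain ⟨G, hG⟩ := exists_pow p _ hL2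
  obtain ⟨B, hB⟩ := exists_pow p (L - X * derivative L) (by
    simp [derivative_mul, hL2])
  obtain ⟨τ, hτ⟩ := const_root p (-τ₁)
  refine ⟨⟨M, G, C τ₁ * X, E, B, τ, p ^ (n-1), i0, j1, 0, ?_, by rw [hf, pow_one], by rw [hG, pow_one],
    ?_, ?_, by rw [hi0, pow_one], ?_, ?_, ?_, ?_, ?_⟩, hcopL, hvr⟩
  · rw [← pow_add]; congr 1; omega
  · rw [pow_one]; nth_rewrite 1 [hTe]; ring
  · intro j hj
    rw [coeff_C_mul, coeff_X] at hj
    refine ⟨0, 0, ?_, by simp⟩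
    by_contra hc
    rw [if_neg (by simpa using Ne.symm hc)] at hj
    simp at hj
  · apply frobenius_inj F[X] p
    simp only [frobenius_def]
    rw [hpow, mul_pow, add_pow_char, ← C_pow, ← hτ, mul_pow, ← hG, ← hB, ← pow_mul, ← pow_succ,
      show n - 1 + 1 = n by omega, C_neg]
    ring
  · rintro rfl
    rw [zero_pow hp.ne_zero] at hτ
    exact hT1 (neg_eq_zero.1 hτ)
  · rw [← natDegree_pow, ← hB, zero_mul, add_zero]
    refine (natDegree_sub_le _ _).trans (max_le le_rfl ?_)
    refine natDegree_mul_le.trans ?_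
    rw [natDegree_X]; omega
  · simp
  · intro h0
    exact hM (by rw [eval_pow, h0, zero_pow hp.ne_zero])
end MV

namespace MV

lemma delta_prod {F : Type*} [Field F] [Fintype F] (q : ℕ) (hq : Fintype.card F = q) :
    ∏ a : F, (X - C a) = X ^ q - X := by
  have h1 : 1 < q := hq ▸ Fintype.one_lt_card
  have h2 := FiniteField.roots_X_pow_card_sub_X F
  rw [hq] at h2
  have h3 := prod_multiset_X_sub_C_of_monic_of_roots_card_eq (p := (X ^ q - X : F[X]))
    (by simpa using monic_X_pow_sub (n := q) (p := X) (by simpa using h1))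
    (by rw [h2, FiniteField.X_pow_card_sub_X_natDegree_eq F h1, ← hq]; rfl)
  rw [h2] at h3
  exact h3

lemma prod_pow_dvd {F : Type*} [Field F] (A : Finset F) (g : F[X]) (m : ℕ)
    (h : ∀ a ∈ A, (X - C a) ^ m ∣ g) : (∏ a ∈ A, (X - C a)) ^ m ∣ g := by
  rw [← Finset.prod_pow]
  refine Finset.prod_dvd_of_coprime ?_ h
  intro a _ b _ hab
  exact (pairwise_coprime_X_sub_C (K := F) (s := id) Function.injective_id hab).pow

lemma fiber_le {F : Type*} [Field F] [Fintype F] [DecidableEq F] (f : F[X]) (hd : 0 < f.natDegree)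
    (γ : F) : (Finset.univ.filter fun a => f.eval a = γ).card ≤ f.natDegree := by
  have hne : f - C γ ≠ 0 := by
    intro h
    rw [sub_eq_zero.1 h] at hd; simp at hd
  by_contra hc
  refine hne (eq_zero_of_natDegree_lt_card_of_eval_eq_zero' _ _ (fun i hi => ?_)
    (show _ < (Finset.univ.filter fun a => f.eval a = γ).card by rw [natDegree_sub_C]; omega))
  simp at hi
  simp [hi]

lemma points_ge {F : Type*} [Field F] [Fintype F] [DecidableEq F] (f : F[X]) (hd : 0 < f.natDegree)
    (S A : Finset F) (hS : ∀ a, f.eval a ∈ S) (hA : A ⊆ S) :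
    Fintype.card F ≤ (Finset.univ.filter fun a => f.eval a ∈ A).card + (S.card - A.card) * f.natDegree := by
  have h1 : (Finset.univ.filter fun a => ¬ f.eval a ∈ A).card ≤ (S.card - A.card) * f.natDegree := by
    rw [← Finset.card_sdiff_of_subset hA]
    have h2 := Finset.card_eq_sum_card_fiberwise (f := fun a => f.eval a)
      (s := Finset.univ.filter fun a => ¬ f.eval a ∈ A) (t := S \ A) (by
        intro a ha
        simp at ha
        simp [ha, hS a])
    rw [h2]
    refine (Finset.sum_le_card_nsmul _ _ f.natDegree ?_).trans (by simp)
    intro b _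
    refine (Finset.card_le_card ?_).trans (fiber_le f hd b)
    intro x hx
    simp at hx ⊢
    exact hx.2
  have h3 := Finset.card_filter_add_card_filter_not (s := (Finset.univ : Finset F)) (fun a => f.eval a ∈ A)
  rw [Finset.card_univ] at h3
  omega

lemma sq_dvd {F : Type*} [Field F] (f : F[X]) (a γ : F) (h : f.eval a = γ)
    (h' : (derivative f).eval a = 0) : (X - C a) ^ 2 ∣ f - C γ := by
  have h1 : X - C a ∣ f - C γ := by rw [← h]; exact X_sub_C_dvd_sub_C_eval
  obtain ⟨u, hu⟩ := h1
  have h2 := congrArg (fun g => eval a (derivative g)) hu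
  simp [derivative_mul, h'] at h2
  obtain ⟨w, hw⟩ := dvd_iff_isRoot.2 (show IsRoot u a from h2.symm)
  exact ⟨w, by rw [hu, hw]; ring⟩

lemma bad_fiber {F : Type*} [Field F] [Fintype F] [DecidableEq F] (f : F[X]) (hd : 0 < f.natDegree)
    (γ : F) (h : ∀ a, f.eval a = γ → (derivative f).eval a = 0) :
    2 * (Finset.univ.filter fun a => f.eval a = γ).card ≤ f.natDegree := by
  have hne : f - C γ ≠ 0 := by
    intro h
    rw [sub_eq_zero.1 h] at hd; simp at hd
  have h1 := prod_pow_dvd (Finset.univ.filter fun a => f.eval a = γ) (f - C γ) 2 (by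
    intro a ha
    simp at ha
    exact sq_dvd f a γ ha (h a ha))
  have h2 := natDegree_le_of_dvd h1 hne
  rw [natDegree_pow, natDegree_finsetProd_X_sub_C_eq_card _ (fun a => a), natDegree_sub_C] at h2
  exact h2

lemma exists_gamma {F : Type*} [Field F] [Fintype F] [DecidableEq F] (f : F[X]) (hd : 0 < f.natDegree)
    (S : Finset F) (hS : ∀ a, f.eval a ∈ S) (r : ℕ) (hr : 2 ≤ r) (hSr : S.card = r + 1)
    (hrd : r * f.natDegree < Fintype.card F) :
    ∃ γ0 ∈ S, ∀ γ ∈ S, γ ≠ γ0 → ∃ a, f.eval a = γ ∧ (derivative f).eval a ≠ 0 := by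
  by_contra hcon
  push Not at hcon
  obtain ⟨g0, hg0⟩ : S.Nonempty := Finset.card_pos.1 (by omega)
  obtain ⟨g1, h1S, -, h1⟩ := hcon g0 hg0
  obtain ⟨g2, h2S, h21, h2⟩ := hcon g1 h1S
  have e1 := bad_fiber f hd g1 h1
  have e2 := bad_fiber f hd g2 h2
  have e3 := points_ge f hd S {g1, g2} hS (by
    intro x hx; simp at hx; rcases hx with rfl | rfl <;> assumption)
  rw [Finset.card_pair h21.symm, hSr] at e3
  have e4 : (Finset.univ.filter fun a => f.eval a ∈ ({g1, g2} : Finset F)).card ≤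
      (Finset.univ.filter fun a => f.eval a = g1).card + (Finset.univ.filter fun a => f.eval a = g2).card := by
    refine le_trans (Finset.card_le_card ?_) (Finset.card_union_le _ _)
    intro x hx
    simp at hx ⊢
    exact hx
  obtain ⟨r', rfl⟩ : ∃ r', r = r' + 1 := ⟨r - 1, by omega⟩
  have e5 : (r' + 1 + 1 - 2) * f.natDegree = r' * f.natDegree := by congr 1
  have e6 : (r' + 1) * f.natDegree = r' * f.natDegree + f.natDegree := by ring
  omega

lemma kernel_exists {F : Type*} [Field F] (t g : Fin 3 → F) :
    ∃ a b c e : F, ¬ (a = 0 ∧ b = 0 ∧ c = 0 ∧ e = 0) ∧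
      ∀ i, - t i * (a * g i + b) + (c * g i + e) = 0 := by
  let M : Matrix (Fin 3) (Fin 4) F := Matrix.of fun i => ![- t i * g i, - t i, g i, 1]
  have h := LinearMap.ker_ne_bot_of_finrank_lt (f := Matrix.mulVecLin M) (by simp)
  obtain ⟨x, hx, hx0⟩ := (Submodule.ne_bot_iff _).1 h
  rw [LinearMap.mem_ker] at hx
  refine ⟨x 0, x 1, x 2, x 3, ?_, ?_⟩
  · rintro ⟨h0, h1, h2, h3⟩
    apply hx0
    funext i
    fin_cases i <;> simp [h0, h1, h2, h3]
  · intro i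
    have := congrFun hx i
    simp [M, Matrix.mulVec, dotProduct, Fin.sum_univ_four] at this
    linear_combination this

lemma bilinear {F : Type*} [Field F] (f h : F[X]) (hd : 0 < f.natDegree) (hh : h ≠ 0)
    (hhd : h.natDegree < f.natDegree) (hf' : derivative f ≠ 0) (a b c e : F)
    (hne : ¬ (a = 0 ∧ b = 0 ∧ c = 0 ∧ e = 0))
    (hN : (C a * f + C b) * h + (C c * f + C e) * derivative f = 0) :
    ∃ κ : F, κ ≠ 0 ∧ h = - C κ * derivative f := by
  have hlin : ∀ x y : F, ¬ (x = 0 ∧ y = 0) → C x * f + C y ≠ 0 := by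
    intro x y hxy h0
    by_cases hx : x = 0
    · simp [hx] at h0; exact hxy ⟨hx, h0⟩
    · have := congrArg natDegree h0
      rw [natDegree_add_C, natDegree_C_mul hx, natDegree_zero] at this
      omega
  have hfd : (derivative f).natDegree < f.natDegree := natDegree_derivative_lt (by omega)
  by_cases hΔ : a * e - b * c = 0
  · have hκ : ∃ κ, c = κ * a ∧ e = κ * b := by
      by_cases ha : a = 0
      · by_cases hb : b = 0
        · exfalso
          rw [ha, hb] at hN
          simp only [C_0, zero_mul, zero_add] at hN
          have := (mul_eq_zero.1 hN).resolve_right hf'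
          exact hlin c e (fun h => hne ⟨ha, hb, h⟩) this
        · refine ⟨e / b, ?_, by field_simp⟩
          rw [ha, zero_mul, zero_sub, neg_eq_zero] at hΔ
          rw [(mul_eq_zero.1 hΔ).resolve_left hb, ha, mul_zero]
      · refine ⟨c / a, by field_simp, ?_⟩
        field_simp
        linear_combination hΔ
    obtain ⟨κ, rfl, rfl⟩ := hκ
    have h1 : (C a * f + C b) * (h + C κ * derivative f) = 0 := by
      rw [← hN]; simp only [C_mul]; ring
    have h2 := (mul_eq_zero.1 h1).resolve_left (hlin a b (by
      rintro ⟨rfl, rfl⟩; simp at hne))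
    refine ⟨κ, ?_, by linear_combination h2⟩
    rintro rfl
    simp at h2; exact hh h2
  · exfalso
    have hcop : IsCoprime (C a * f + C b) (C c * f + C e) := by
      refine ⟨C (-(a * e - b * c)⁻¹ * c), C ((a * e - b * c)⁻¹ * a), ?_⟩
      have : (1 : F[X]) = C ((a * e - b * c)⁻¹) * C (a * e - b * c) := by
        rw [← C_mul, inv_mul_cancel₀ hΔ, C_1]
      rw [this]
      simp only [C_mul, C_neg, C_sub]; ring
    have hdv : C a * f + C b ∣ derivative f := by
      refine hcop.dvd_of_dvd_mul_left (y := C c * f + C e) ⟨- h, by linear_combination hN⟩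
    have ha : a = 0 := by
      by_contra ha
      have := natDegree_le_of_dvd hdv hf'
      rw [natDegree_add_C, natDegree_C_mul ha] at this
      omega
    subst ha
    have hbc : b ≠ 0 ∧ c ≠ 0 := by
      constructor <;> (rintro rfl; simp at hΔ)
    have h1 : (C c * f + C e) * derivative f = - (C b * h) := by
      simp only [C_0, zero_mul, zero_add] at hN
      linear_combination hN
    have h2 := congrArg natDegree h1
    rw [natDegree_mul (hlin c e (fun h => hbc.2 h.1)) hf', natDegree_neg, natDegree_C_mul hbc.1,
      natDegree_add_C, natDegree_C_mul hbc.2] at h2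
    omega
end MV

namespace MV

lemma base_id {F : Type*} [Field F] [Fintype F] [DecidableEq F] (p n r : ℕ) [Fact p.Prime] [CharP F p]
    (hn : 1 ≤ n) (hq : Fintype.card F = p ^ n) (f : F[X]) (hd : 0 < f.natDegree)
    (S : Finset F) (hS : ∀ a, f.eval a ∈ S) (hr : 2 ≤ r) (hSr : S.card = r + 1)
    (hrd : r * f.natDegree < p ^ n) (hrd2 : p ^ n ≤ (r + 1) * f.natDegree) :
    ∃ t : F, t ≠ 0 ∧ (∏ s ∈ S, (X - C s)).comp f = - C t * (X ^ p ^ n - X) * derivative f ∧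
      derivative f ≠ 0 ∧
      ∀ a, (derivative f).eval a ≠ 0 → (derivative (∏ s ∈ S, (X - C s))).eval (f.eval a) = t := by
  set T := ∏ s ∈ S, (X - C s) with hT
  have hTd : T.natDegree = r + 1 := by
    rw [hT, natDegree_finsetProd_X_sub_C_eq_card _ (fun a => a), hSr]
  have hTmon : T.Monic := monic_prod_X_sub_C _ _
  have hTroot : ∀ γ ∈ S, T.eval γ = 0 := by
    intro γ hγ
    rw [hT, eval_prod]
    exact Finset.prod_eq_zero hγ (by simp)
  have hD := deriv_delta (F := F) p n hn
  have hdv : X ^ p ^ n - X ∣ T.comp f := by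
    rw [← delta_prod _ hq]
    have := prod_pow_dvd Finset.univ (T.comp f) 1 (by
      intro a _
      rw [pow_one, dvd_iff_isRoot, IsRoot, eval_comp]
      exact hTroot _ (hS a))
    rwa [pow_one] at this
  obtain ⟨h, hh⟩ := hdv
  have hTf0 : T.comp f ≠ 0 := by
    intro h0
    have := congrArg natDegree h0
    rw [natDegree_comp, hTd, natDegree_zero] at this
    have : 0 < (r+1) * f.natDegree := by positivity
    omega
  have hh0 : h ≠ 0 := by rintro rfl; rw [mul_zero] at hh; exact hTf0 hh
  have hq1 : 1 < p ^ n := hq ▸ Fintype.one_lt_card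
  have hhd : h.natDegree < f.natDegree := by
    have := congrArg natDegree hh
    rw [natDegree_comp, hTd, natDegree_mul (delta_ne p n hn) hh0,
      FiniteField.X_pow_card_sub_X_natDegree_eq F hq1] at this
    have e : (r + 1) * f.natDegree = r * f.natDegree + f.natDegree := by ring
    omega
  have h2d : 2 * f.natDegree ≤ r * f.natDegree := Nat.mul_le_mul_right _ hr
  have hpt : ∀ a, (derivative T).eval (f.eval a) * (derivative f).eval a = - h.eval a := by
    intro a
    have := congrArg (fun g => eval a (derivative g)) hh
    simp only [derivative_comp, derivative_mul, hD] at this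
    rw [eval_mul, eval_comp] at this
    have e : a ^ p ^ n = a := by rw [← hq]; exact FiniteField.pow_card a
    simp [e] at this
    linear_combination this
  have hf' : derivative f ≠ 0 := by
    intro h0
    refine hh0 (eq_zero_of_natDegree_lt_card_of_eval_eq_zero' h Finset.univ (fun a _ => ?_) ?_)
    · have := hpt a
      rw [h0] at this; simpa using this
    · rw [Finset.card_univ, hq]; omega
  obtain ⟨A, hAS, hA3⟩ := Finset.exists_subset_card_eq (show 3 ≤ S.card by omega)
  let g : Fin 3 → F := fun i => (A.equivFinOfCardEq hA3).symm i
  obtain ⟨a, b, c, e, hne, hker⟩ := kernel_exists (fun i => (derivative T).eval (g i)) g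
  have hN : (C a * f + C b) * h + (C c * f + C e) * derivative f = 0 := by
    refine eq_zero_of_natDegree_lt_card_of_eval_eq_zero' _
      (Finset.univ.filter fun x => f.eval x ∈ A) (fun x hx => ?_) ?_
    · simp at hx
      have e1 := hker (A.equivFinOfCardEq hA3 ⟨_, hx⟩)
      simp [g] at e1
      have e2 := hpt x
      simp only [eval_add, eval_mul, eval_C]
      linear_combination (derivative f).eval x * e1 + (a * f.eval x + b) * e2
    · have e1 := points_ge f hd S A hS hAS
      rw [hSr, hA3, hq] at e1
      obtain ⟨r', rfl⟩ : ∃ r', r = r' + 2 := ⟨r - 2, by omega⟩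
      have e5 : (r' + 2 + 1 - 3) * f.natDegree = r' * f.natDegree := by congr 1
      have e6 : (r' + 2) * f.natDegree = r' * f.natDegree + 2 * f.natDegree := by ring
      have hlin : ∀ x y : F, (C x * f + C y).natDegree ≤ f.natDegree := fun x y => by
        rw [natDegree_add_C]; exact natDegree_C_mul_le _ _
      have e7 := natDegree_derivative_lt (show f.natDegree ≠ 0 by omega)
      have e8 := natDegree_mul_le (p := C a * f + C b) (q := h)
      have e9 := natDegree_mul_le (p := C c * f + C e) (q := derivative f)
      have e10 := natDegree_add_le ((C a * f + C b) * h) ((C c * f + C e) * derivative f)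
      have e11 := hlin a b
      have e12 := hlin c e
      omega
  obtain ⟨t, ht, hht⟩ := bilinear f h hd hh0 hhd hf' a b c e hne hN
  refine ⟨t, ht, by rw [hh, hht]; ring, hf', fun x hx => ?_⟩
  have e1 := hpt x
  rw [hht] at e1
  simp at e1
  exact e1.resolve_right hx

lemma fwd {F : Type*} [Field F] [Fintype F] [DecidableEq F] (p n r : ℕ) [Fact p.Prime] [CharP F p]
    (hn : 1 ≤ n) (hq : Fintype.card F = p ^ n) (f : F[X]) (hd : 0 < f.natDegree)
    (S : Finset F) (hS : ∀ a, f.eval a ∈ S) (hr : 2 ≤ r) (hSr : S.card = r + 1)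
    (hrd : r * f.natDegree < p ^ n) (hrd2 : p ^ n ≤ (r + 1) * f.natDegree)
    (h0S : (0:F) ∈ S) (h0f : ∃ a, f.eval a = 0)
    (hsimp : ∀ γ ∈ S, γ ≠ 0 → ∃ a, f.eval a = γ ∧ (derivative f).eval a ≠ 0) :
    ∃ v, 0 < v ∧ ¬ p ∣ v ∧ ∀ j, (∏ s ∈ S, (X - C s)).coeff j ≠ 0 → Adm p v j := by
  have hp := (Fact.out : p.Prime)
  obtain ⟨t, ht, hTf, hf', htan⟩ := base_id p n r hn hq f hd S hS hr hSr hrd hrd2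
  set T := ∏ s ∈ S, (X - C s) with hT
  have hTd : T.natDegree = r + 1 := by
    rw [hT, natDegree_finsetProd_X_sub_C_eq_card _ (fun a => a), hSr]
  have hTmon : T.Monic := monic_prod_X_sub_C _ _
  have hTroot : ∀ γ, T.eval γ = 0 ↔ γ ∈ S := by
    intro γ
    rw [hT, eval_prod, Finset.prod_eq_zero_iff]
    constructor
    · rintro ⟨a, ha, h⟩
      simp [sub_eq_zero] at h
      rwa [h]
    · intro h; exact ⟨γ, h, by simp⟩
  have hT0 : T.coeff 0 = 0 := by rw [coeff_zero_eq_eval_zero]; exact (hTroot 0).2 h0S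
  have hrq : r + 1 ≤ p ^ n := by
    have : r * 1 ≤ r * f.natDegree := Nat.mul_le_mul_left _ hd
    omega
  by_cases h0 : ∃ a, f.eval a = 0 ∧ (derivative f).eval a ≠ 0
  · refine ⟨1, one_pos, fun h => hp.one_lt.ne' (Nat.dvd_one.1 h), ?_⟩
    have hall : ∀ γ, T.eval γ = 0 → ∃ a, f.eval a = γ ∧ (derivative f).eval a ≠ 0 := by
      intro γ hγ
      by_cases hγ0 : γ = 0
      · rw [hγ0]; exact h0
      · exact hsimp γ ((hTroot γ).1 hγ) hγ0
    have hT' : derivative T = C t := by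
      rw [← sub_eq_zero]
      refine eq_zero_of_natDegree_lt_card_of_eval_eq_zero' _ S (fun γ hγ => ?_) ?_
      · obtain ⟨a, h1, h2⟩ := hall γ ((hTroot γ).2 hγ)
        have := htan a h2
        rw [h1] at this
        simp [this]
      · rw [natDegree_sub_C]
        have := natDegree_derivative_le T
        omega
    have hfin := final1 p n f T t hd hf' hTf hall hn (by omega) (base1 p n f T t ht hTf hn hT')
    intro j hj
    have hj0 : j ≠ 0 := by rintro rfl; exact hj hT0
    obtain ⟨i, hi⟩ := hfin j hj0 hj
    exact ⟨j - 1, i, by omega, by omega⟩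
  · push Not at h0
    set Z := Finset.univ.filter fun a => f.eval a = 0 with hZ
    have hf0 : f ≠ 0 := by rintro rfl; simp at hd
    have hZne : Z.Nonempty := by
      obtain ⟨a, ha⟩ := h0f
      exact ⟨a, by simp [hZ, ha]⟩
    obtain ⟨α, hαZ, hαmin⟩ := Finset.exists_min_image Z (fun a => rootMultiplicity a f) hZne
    set v := rootMultiplicity α f with hv
    have hαf : f.eval α = 0 := by simpa [hZ] using hαZ
    have hv2 : 2 ≤ v := by
      rw [hv, le_rootMultiplicity_iff hf0]
      have := sq_dvd f α 0 hαf (h0 α hαf)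
      simpa using this
    set L := ∏ a ∈ Z, (X - C a) with hLdef
    have hLv : L ^ v ∣ f := prod_pow_dvd Z f v (fun a ha => (le_rootMultiplicity_iff hf0).1 (hαmin a ha))
    obtain ⟨M₁, hM₁⟩ := hLv
    have hLd : 0 < L.natDegree := by
      rw [hLdef, natDegree_finsetProd_X_sub_C_eq_card _ (fun a => a)]
      exact Finset.card_pos.2 hZne
    have hLα : L.eval α = 0 := by
      rw [hLdef, eval_prod]; exact Finset.prod_eq_zero hαZ (by simp)
    have hM₁α : M₁.eval α ≠ 0 := by
      intro h
      have e1 : X - C α ∣ M₁ := dvd_iff_isRoot.2 h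
      have e2 : X - C α ∣ L := dvd_iff_isRoot.2 hLα
      have e3 : (X - C α) ^ (v + 1) ∣ f := by
        rw [hM₁, pow_succ]
        exact mul_dvd_mul (pow_dvd_pow_of_dvd e2 v) e1
      have := (le_rootMultiplicity_iff hf0).2 e3
      omega
    set Lh := ∏ a ∈ Finset.univ.filter (fun a => ¬ f.eval a = 0), (X - C a) with hLh
    have hδ : X ^ p ^ n - X = L * Lh := by
      rw [← delta_prod _ hq]
      exact (Finset.prod_filter_mul_prod_filter_not _ _ _).symm
    have hcop : IsCoprime Lh M₁ := by
      refine IsCoprime.prod_left fun a ha => ?_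
      simp at ha
      rw [(irreducible_X_sub_C a).coprime_iff_not_dvd, dvd_iff_isRoot]
      intro h
      apply ha
      rw [hM₁, eval_mul, h.eq_zero, mul_zero]
    obtain ⟨T₁, hT₁⟩ : X ∣ T := X_dvd_iff.2 hT0
    have hT₁0 : T₁.coeff 0 ≠ 0 := by
      have e1 : T = X * ∏ s ∈ S.erase 0, (X - C s) := by
        rw [hT, ← Finset.mul_prod_erase S _ h0S]; simp
      have e2 : T₁ = ∏ s ∈ S.erase 0, (X - C s) := by
        apply mul_left_cancel₀ (X_ne_zero (R := F))
        rw [← hT₁, e1]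
      rw [e2, coeff_zero_eq_eval_zero, eval_prod, Finset.prod_ne_zero_iff]
      intro a ha
      simp at ha
      simpa using ha.1
    have hTX : X * derivative T - C t * X = C ((r:F) + 1) * T := by
      rw [← sub_eq_zero]
      refine eq_zero_of_natDegree_lt_card_of_eval_eq_zero' _ S (fun γ hγ => ?_) ?_
      · have e1 := (hTroot γ).2 hγ
        simp only [eval_sub, eval_mul, eval_X, eval_C, e1]
        by_cases hγ0 : γ = 0
        · simp [hγ0]
        · obtain ⟨a, h1, h2⟩ := hsimp γ hγ hγ0
          have := htan a h2
          rw [h1] at this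
          rw [this]; ring
      · rw [hSr, Nat.lt_succ_iff, natDegree_le_iff_coeff_eq_zero]
        intro N hN
        obtain ⟨m, rfl⟩ : ∃ m, N = m + 1 := ⟨N - 1, by omega⟩
        rw [coeff_sub, coeff_sub, coeff_X_mul, coeff_derivative, coeff_C_mul, coeff_C_mul, coeff_X,
          if_neg (by omega)]
        by_cases hm : m = r
        · rw [hm]; ring
        · rw [coeff_eq_zero_of_natDegree_lt (show T.natDegree < m + 1 by omega)]; simp
    have hTf2 : f * T₁.comp f = - C t * (X ^ p ^ n - X) * derivative f := by
      rw [← hTf, hT₁, mul_comp, X_comp]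
    obtain ⟨hlev, hLcop, hvr⟩ := base2 p n v r hv2 hn f T₁ L Lh M₁ α t ht hT₁0 hTf2 (hT₁ ▸ hTX)
      hLd hδ hcop hM₁ hLα hM₁α
    rw [← hT₁] at hlev
    refine ⟨v, by omega, ?_, ?_⟩
    · intro h
      have h1 := (cast_zero (F := F) p _).1 hvr
      have h2 : p ∣ 1 := (Nat.dvd_add_right (h.mul_right r)).1 h1
      exact hp.one_lt.ne' (Nat.dvd_one.1 h2)
    · refine final2 p n v hv2 f T L α hLd hLα hLcop hn ?_ hlev
      intro j hj
      have h1 := le_natDegree_of_ne_zero hj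
      have h2 : v ≤ f.natDegree := by
        have e1 := natDegree_le_of_dvd ⟨M₁, hM₁⟩ hf0
        rw [natDegree_pow] at e1
        exact (Nat.le_mul_of_pos_right v hLd).trans e1
      have h3 : v * (j - 1) ≤ v * r := Nat.mul_le_mul_left _ (by omega)
      have h4 : v * r ≤ f.natDegree * r := Nat.mul_le_mul_right _ h2
      rw [mul_comm f.natDegree r] at h4
      omega
end MV

namespace MV

section E
variable {F : Type*} [Field F] {K : Type*} [Field K] [Algebra F K]

noncomputable def Lam (v : ℕ) (T : F[X]) (y : K) : K :=
  ∑ j ∈ T.support, algebraMap F K (T.coeff j) * y^(v*(j-1)+1)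

lemma Lam_add (p : ℕ) [Fact p.Prime] [CharP K p] (v : ℕ) (T : F[X])
    (hT : ∀ j, T.coeff j ≠ 0 → Adm p v j) (x y : K) :
    Lam v T (x+y) = Lam v T x + Lam v T y := by
  unfold Lam
  rw [← Finset.sum_add_distrib]
  apply Finset.sum_congr rfl
  intro j hj
  obtain ⟨j', i, rfl, h⟩ := hT j (mem_support_iff.mp hj)
  rw [Nat.add_sub_cancel, h, add_pow_char_pow]
  ring

lemma Lam_smul (p : ℕ) (v k0 : ℕ) (hk : ∀ i, v ∣ p^i - 1 → k0 ∣ i) (T : F[X])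
    (hT : ∀ j, T.coeff j ≠ 0 → Adm p v j) (c y : K) (hc : c^(p^k0) = c) :
    Lam v T (c*y) = c * Lam v T y := by
  have hpow : ∀ t, c^(p^(k0*t)) = c := by
    intro t
    induction t with
    | zero => simp
    | succ t ih => rw [Nat.mul_succ, pow_add, pow_mul, ih, hc]
  unfold Lam
  rw [Finset.mul_sum]
  apply Finset.sum_congr rfl
  intro j hj
  obtain ⟨j', i, rfl, h⟩ := hT j (mem_support_iff.mp hj)
  obtain ⟨t, rfl⟩ := hk i ⟨j', by omega⟩
  rw [Nat.add_sub_cancel, h, mul_pow, hpow]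
  ring

lemma Lam_aeval (p : ℕ) (v : ℕ) (hv : 0 < v) (T : F[X])
    (hT : ∀ j, T.coeff j ≠ 0 → Adm p v j) (y : K) :
    y^(v-1) * Lam v T y = aeval (y^v) T := by
  rw [aeval_def, eval₂_eq_sum, Polynomial.sum_def]
  unfold Lam
  rw [Finset.mul_sum]
  apply Finset.sum_congr rfl
  intro j hj
  obtain ⟨j', i, rfl, h⟩ := hT j (mem_support_iff.mp hj)
  rw [Nat.add_sub_cancel, ← pow_mul]
  have : v * (j'+1) = (v-1) + (v*j'+1) := by rw [Nat.mul_succ]; omega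
  rw [this, pow_add]; ring

lemma aeval_prod (S : Finset F) (x : K) :
    aeval x (∏ s ∈ S, (X - C s)) = 0 ↔ ∃ s ∈ S, x = algebraMap F K s := by
  rw [map_prod, Finset.prod_eq_zero_iff]
  simp [sub_eq_zero]

lemma Lam_zero_iff (p : ℕ) (v : ℕ) (hv : 0 < v) (S : Finset F) (h0 : 0 ∈ S)
    (hT : ∀ j, (∏ s ∈ S, (X - C s)).coeff j ≠ 0 → Adm p v j) (y : K) :
    Lam v (∏ s ∈ S, (X - C s)) y = 0 ↔ ∃ s ∈ S, y^v = algebraMap F K s := by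
  rw [← aeval_prod, ← Lam_aeval p v hv _ hT]
  by_cases hy : y = 0
  · subst hy
    have : Lam v (∏ s ∈ S, (X - C s)) (0:K) = 0 := by simp [Lam]
    simp [this]
  · simp [hy]

lemma U_props (p v k0 : ℕ) [Fact p.Prime] [CharP K p] [IsAlgClosed K] (hv : 0 < v)
    (hk : ∀ i, v ∣ p^i - 1 → k0 ∣ i) (S : Finset F) (h0 : 0 ∈ S)
    (hT : ∀ j, (∏ s ∈ S, (X - C s)).coeff j ≠ 0 → Adm p v j) (s0 : F) :
    (∀ x y : K, (∃ s ∈ S, algebraMap F K s0 * x^v = algebraMap F K s) →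
      (∃ s ∈ S, algebraMap F K s0 * y^v = algebraMap F K s) →
      (∃ s ∈ S, algebraMap F K s0 * (x+y)^v = algebraMap F K s)) ∧
    (∀ c x : K, c^(p^k0) = c → (∃ s ∈ S, algebraMap F K s0 * x^v = algebraMap F K s) →
      (∃ s ∈ S, algebraMap F K s0 * (c*x)^v = algebraMap F K s)) := by
  obtain ⟨y0, hy0⟩ := IsAlgClosed.exists_pow_nat_eq (algebraMap F K s0) hv
  simp_rw [← hy0, ← mul_pow, ← Lam_zero_iff p v hv S h0 hT]
  constructor
  · intro x y hx hy
    rw [mul_add, Lam_add p v _ hT, hx, hy, add_zero]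
  · intro c x hc hx
    rw [mul_left_comm, Lam_smul p v k0 hk _ hT _ _ hc, hx, mul_zero]

lemma mem_range_of_pow [Fintype F] (q : ℕ) (hq : Fintype.card F = q) (y : K) (hy : y^q = y) :
    ∃ a, algebraMap F K a = y := by
  have h := congrArg (aeval y) (delta_prod (F := F) q hq)
  have h2 : aeval y (X^q - X : F[X]) = 0 := by simp [hy]
  rw [h2, aeval_prod] at h
  obtain ⟨s, _, hs⟩ := h
  exact ⟨s, hs.symm⟩

lemma exists_k0 (p v : ℕ) (hp : p.Prime) (hv : 0 < v) (hpv : ¬ p ∣ v) :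
    ∃ k0, 1 ≤ k0 ∧ v ∣ p^k0 - 1 ∧ ∀ i, v ∣ p^i - 1 → k0 ∣ i := by
  have hc : p.Coprime v := (Nat.Prime.coprime_iff_not_dvd hp).mpr hpv
  haveI : NeZero v := ⟨hv.ne'⟩
  have key : ∀ i, v ∣ p^i - 1 ↔ orderOf (ZMod.unitOfCoprime p hc) ∣ i := by
    intro i
    rw [orderOf_dvd_iff_pow_eq_one, Units.ext_iff]
    have h1 : 1 ≤ p^i := Nat.one_le_pow _ _ hp.pos
    rw [← Nat.modEq_iff_dvd' h1, ← ZMod.natCast_eq_natCast_iff]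
    simp [eq_comm]
  refine ⟨_, orderOf_pos _, (key _).mpr dvd_rfl, fun i => (key i).mp⟩
end E
end MV

namespace MV

section E
variable {F : Type*} [Field F] [Fintype F] [DecidableEq F] {K : Type*} [Field K] [Algebra F K]

lemma pow_iter (c : K) (Q n m : ℕ) (h : c^(Q^n) = c) (hm : n ∣ m) : c^(Q^m) = c := by
  obtain ⟨t, rfl⟩ := hm
  induction t with
  | zero => simp
  | succ t ih => rw [Nat.mul_succ, pow_add, pow_mul, ih, h]

lemma pow_of_dvd (c : K) (v m : ℕ) (hm : 0 < m) (h : c^v = 1) (hv : v ∣ m - 1) : c^m = c := by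
  obtain ⟨t, ht⟩ := hv
  have : m = v*t + 1 := by omega
  rw [this, pow_succ, pow_mul, h, one_pow, one_mul]

lemma pow_sub_one_of (c : K) (m : ℕ) (hm : 0 < m) (h : c^m = c) (hc : c ≠ 0) : c^(m-1) = 1 := by
  have : m = (m-1)+1 := by omega
  rw [this, pow_succ] at h
  exact mul_right_cancel₀ hc (by rw [h, one_mul])

lemma zeta (p v k0 q : ℕ) [Fact p.Prime] (hvk : v ∣ p^k0 - 1) (hq : Fintype.card F = q)
    (S : Finset F) (s0 : F) (hs0' : s0 ≠ 0) (w : K)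
    (hw : ∃ s ∈ S, algebraMap F K s0 * w^v = algebraMap F K s) :
    ∃ ζ : K, ζ^(p^k0) = ζ ∧ w^q = ζ * w := by
  have hp : p.Prime := Fact.out
  have hpk : 0 < p^k0 := pow_pos hp.pos _
  have hq0 : 0 < q := hq ▸ Fintype.card_pos
  by_cases h : w = 0
  · subst h
    exact ⟨1, by simp, by simp [hq0.ne']⟩
  · refine ⟨w^(q-1), ?_, ?_⟩
    · apply pow_of_dvd _ v _ hpk _ hvk
      obtain ⟨s, hs, e⟩ := hw
      have hi : algebraMap F K s0 ≠ 0 := by simpa using hs0'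
      have e2 : w^v = algebraMap F K (s/s0) := by
        rw [map_div₀, eq_div_iff hi, mul_comm, e]
      rw [← pow_mul, mul_comm, pow_mul]
      apply pow_sub_one_of _ _ hq0 _ (pow_ne_zero _ h)
      rw [e2, ← map_pow, ← hq, FiniteField.pow_card]
    · rw [← pow_succ]; congr 1; omega

lemma case1 (p v k0 n : ℕ) [Fact p.Prime] [CharP K p] [CharP F p] [IsAlgClosed K] (hv : 0 < v) (hpv : ¬ p ∣ v)
    (hvk : v ∣ p^k0 - 1) (hk : ∀ i, v ∣ p^i - 1 → k0 ∣ i) (hq : Fintype.card F = p^n)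
    (S : Finset F) (h0 : 0 ∈ S) (s0 : F) (hs0 : s0 ∈ S) (hs0' : s0 ≠ 0)
    (hadd : ∀ x y : K, (∃ s ∈ S, algebraMap F K s0 * x^v = algebraMap F K s) →
      (∃ s ∈ S, algebraMap F K s0 * y^v = algebraMap F K s) →
      (∃ s ∈ S, algebraMap F K s0 * (x+y)^v = algebraMap F K s))
    (hsm : ∀ c x : K, c^(p^k0) = c → (∃ s ∈ S, algebraMap F K s0 * x^v = algebraMap F K s) →
      (∃ s ∈ S, algebraMap F K s0 * (c*x)^v = algebraMap F K s))
    (u : K) (hu : ∃ s ∈ S, algebraMap F K s0 * u^v = algebraMap F K s) (hu' : u^(p^k0) ≠ u) :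
    k0 ∣ n ∧ ∃ U : Finset F, (0 ∈ U ∧ (∀ x ∈ U, ∀ y ∈ U, x + y ∈ U) ∧ (∀ x ∈ U, -x ∈ U) ∧
      (∀ c : F, c^(p^k0) = c → ∀ x ∈ U, c*x ∈ U)) ∧ 1 ∈ U ∧ S = U.image (fun u => s0*u^v) := by
  have hp : p.Prime := Fact.out
  have hpk : 0 < p^k0 := pow_pos hp.pos _
  have hpn : 0 < p^n := pow_pos hp.pos _
  have hi : algebraMap F K s0 ≠ 0 := by simpa using hs0'
  have h1 : ∃ s ∈ S, algebraMap F K s0 * (1:K)^v = algebraMap F K s := ⟨s0, hs0, by simp⟩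
  have hE : ∀ c : K, c^(p^k0) = c → ∃ s ∈ S, algebraMap F K s0 * c^v = algebraMap F K s := by
    intro c hc
    have := hsm c 1 hc h1
    rwa [mul_one] at this
  have key : ∀ u : K, (∃ s ∈ S, algebraMap F K s0 * u^v = algebraMap F K s) → u^(p^k0) ≠ u →
      u^(p^n) = u := by
    intro u hu hu'
    obtain ⟨z, hz, hz2⟩ := zeta p v k0 _ hvk hq S s0 hs0' u hu
    obtain ⟨z', hz', hz2'⟩ := zeta p v k0 _ hvk hq S s0 hs0' (1+u) (hadd _ _ h1 hu)
    rw [add_pow_char_pow, one_pow, hz2] at hz2'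
    have e : (z - z') * u = z' - 1 := by linear_combination hz2'
    by_cases hzz : z = z'
    · subst hzz
      have : z = 1 := by
        rw [sub_self, zero_mul] at e
        linear_combination -e
      rw [hz2, this, one_mul]
    · exfalso
      apply hu'
      have : u = (z'-1)/(z-z') := by
        rw [eq_div_iff (sub_ne_zero.mpr hzz), ← e, mul_comm]
      rw [this, div_pow, sub_pow_char_pow, sub_pow_char_pow, hz, hz', one_pow]
  have hEq : ∀ c : K, c^(p^k0) = c → c^(p^n) = c := by
    intro c hc
    have h2 : (c+u)^(p^k0) ≠ c+u := by
      rw [add_pow_char_pow, hc]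
      intro h; exact hu' (add_left_cancel h)
    have := key _ (hadd _ _ (hE c hc) hu) h2
    rw [add_pow_char_pow, key u hu hu'] at this
    exact add_right_cancel this
  have hall : ∀ w : K, (∃ s ∈ S, algebraMap F K s0 * w^v = algebraMap F K s) → w^(p^n) = w := by
    intro w hw
    by_cases h : w^(p^k0) = w
    · exact hEq w h
    · exact key w hw h
  have hP : ∀ x : F, (∃ s ∈ S, algebraMap F K s0 * (algebraMap F K x)^v = algebraMap F K s) ↔ s0*x^v ∈ S := by
    intro x
    constructor
    · rintro ⟨s, hs, e⟩
      rw [← map_pow, ← map_mul] at e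
      rwa [(algebraMap F K).injective e]
    · intro h
      exact ⟨_, h, by simp⟩
  constructor
  · apply hk
    have : NeZero (v:K) := ⟨by rw [Ne, cast_zero p]; exact hpv⟩
    obtain ⟨z, hz⟩ := HasEnoughRootsOfUnity.exists_primitiveRoot K v
    rw [← hz.pow_eq_one_iff_dvd]
    apply pow_sub_one_of _ _ hpn _ (hz.ne_zero hv.ne')
    apply hEq
    exact pow_of_dvd _ v _ hpk hz.pow_eq_one hvk
  · refine ⟨Finset.univ.filter (fun x => s0*x^v ∈ S), ⟨?_, ?_, ?_, ?_⟩, ?_, ?_⟩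
    · simp [hv.ne', h0]
    · intro x hx y hy
      simp only [Finset.mem_filter, Finset.mem_univ, true_and, ← hP, map_add] at *
      exact hadd _ _ hx hy
    · intro x hx
      simp only [Finset.mem_filter, Finset.mem_univ, true_and, ← hP, map_neg] at *
      have := hsm (-1) _ (by
        rcases Nat.even_or_odd (p^k0) with h | h
        · have h2 : p = 2 := by
            rcases hp.eq_two_or_odd' with h' | h'
            · exact h'
            · exact absurd h (by simpa using h'.pow)
          subst h2
          have h3 : (2:K) = 0 := by exact_mod_cast CharP.cast_eq_zero K 2
          rw [h.neg_one_pow]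
          linear_combination h3
        · exact h.neg_one_pow) hx
      rwa [neg_one_mul] at this
    · intro c hc x hx
      simp only [Finset.mem_filter, Finset.mem_univ, true_and, ← hP, map_mul] at *
      exact hsm _ _ (by rw [← map_pow, hc]) hx
    · simpa using hs0
    · ext s
      simp only [Finset.mem_image, Finset.mem_filter, Finset.mem_univ, true_and]
      constructor
      · intro hs
        obtain ⟨w, hw⟩ := IsAlgClosed.exists_pow_nat_eq (algebraMap F K (s/s0)) hv
        have e : algebraMap F K s0 * w^v = algebraMap F K s := by
          rw [hw, ← map_mul, mul_div_cancel₀ _ hs0']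
        obtain ⟨x, rfl⟩ := mem_range_of_pow (F := F) _ hq w (hall w ⟨s, hs, e⟩)
        rw [← map_pow, ← map_mul] at e
        have := (algebraMap F K).injective e
        exact ⟨x, this ▸ hs, this⟩
      · rintro ⟨x, hx, rfl⟩
        exact hx

lemma case2 (p v k0 n : ℕ) [Fact p.Prime] [CharP K p] [CharP F p] [IsAlgClosed K] (hv : 0 < v) (hk0 : 1 ≤ k0) (hn : 1 ≤ n)
    (hvk : v ∣ p^k0 - 1) (hq : Fintype.card F = p^n)
    (S : Finset F) (h0 : 0 ∈ S) (s0 : F) (hs0 : s0 ∈ S) (hs0' : s0 ≠ 0)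
    (hsm : ∀ c x : K, c^(p^k0) = c → (∃ s ∈ S, algebraMap F K s0 * x^v = algebraMap F K s) →
      (∃ s ∈ S, algebraMap F K s0 * (c*x)^v = algebraMap F K s))
    (hU : ∀ u : K, (∃ s ∈ S, algebraMap F K s0 * u^v = algebraMap F K s) → u^(p^k0) = u) :
    ∃ k, k ∣ n ∧ 1 ≤ k ∧ ∃ U : Finset F, (0 ∈ U ∧ (∀ x ∈ U, ∀ y ∈ U, x + y ∈ U) ∧ (∀ x ∈ U, -x ∈ U) ∧
      (∀ c : F, c^(p^k) = c → ∀ x ∈ U, c*x ∈ U)) ∧ 1 ∈ U ∧ ∃ v', 0 < v' ∧ v' ∣ p^k - 1 ∧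
       S = U.image (fun u => s0*u^v') := by
  have hp : p.Prime := Fact.out
  have hpk : 0 < p^k0 := pow_pos hp.pos _
  have hpn : 0 < p^n := pow_pos hp.pos _
  have hi : algebraMap F K s0 ≠ 0 := by simpa using hs0'
  have h1 : ∃ s ∈ S, algebraMap F K s0 * (1:K)^v = algebraMap F K s := ⟨s0, hs0, by simp⟩
  have hE : ∀ c : K, c^(p^k0) = c → ∃ s ∈ S, algebraMap F K s0 * c^v = algebraMap F K s := by
    intro c hc
    have := hsm c 1 hc h1
    rwa [mul_one] at this
  obtain ⟨ρ, hρ⟩ := hvk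
  have hpk1 : 0 < p^k0 - 1 := by
    have := Nat.one_lt_pow (by omega : k0 ≠ 0) hp.one_lt
    omega
  have hρ0 : 0 < ρ := by
    rcases Nat.eq_zero_or_pos ρ with h | h
    · rw [h, mul_zero] at hρ; omega
    · exact h
  have hρp : ¬ p ∣ ρ := by
    intro h
    have h2 : p ∣ p^k0 - 1 := hρ ▸ h.mul_left v
    have h3 : p ∣ p^k0 := dvd_pow_self _ (by omega)
    have := (Nat.dvd_sub_iff_right (by omega) h3).mp h2
    exact hp.one_lt.ne' (Nat.dvd_one.mp this)
  -- roots of unity of order ρ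
  have hA : ∀ x : K, x^ρ = 1 → ∃ s ∈ S, algebraMap F K s0 * x = algebraMap F K s := by
    intro x hx
    obtain ⟨w, hw⟩ := IsAlgClosed.exists_pow_nat_eq x hv
    rw [← hw]
    apply hE
    apply pow_of_dvd w (v*ρ) _ hpk _ (by rw [hρ])
    rw [pow_mul, hw, hx]
  have hB : ∀ s ∈ S, s ≠ 0 → (s/s0)^ρ = 1 := by
    intro s hs hs'
    obtain ⟨w, hw⟩ := IsAlgClosed.exists_pow_nat_eq (algebraMap F K (s/s0)) hv
    have e : algebraMap F K s0 * w^v = algebraMap F K s := by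
      rw [hw, ← map_mul, mul_div_cancel₀ _ hs0']
    have e2 := hU w ⟨s, hs, e⟩
    have hw0 : w ≠ 0 := by
      rintro rfl
      rw [zero_pow hv.ne'] at hw
      have := (map_eq_zero _).mp hw.symm
      exact div_ne_zero hs' hs0' this
    have e3 := pow_sub_one_of w _ hpk e2 hw0
    rw [hρ, pow_mul, hw, ← map_pow] at e3
    exact (algebraMap F K).injective (by rw [e3, map_one])
  have hρn : ρ ∣ p^n - 1 := by
    have : NeZero (ρ:K) := ⟨by rw [Ne, cast_zero p]; exact hρp⟩
    obtain ⟨z, hz⟩ := HasEnoughRootsOfUnity.exists_primitiveRoot K ρ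
    rw [← hz.pow_eq_one_iff_dvd]
    apply pow_sub_one_of _ _ hpn _ (hz.ne_zero hρ0.ne')
    obtain ⟨s, hs, e⟩ := hA z hz.pow_eq_one
    have e2 : z = algebraMap F K (s/s0) := by
      rw [map_div₀, eq_div_iff hi, mul_comm, e]
    rw [e2, ← map_pow, ← hq, FiniteField.pow_card]
  have hk1 : 1 ≤ k0.gcd n := Nat.gcd_pos_of_pos_left _ hk0
  have hρk : ρ ∣ p^(k0.gcd n) - 1 := by
    rw [← Nat.pow_sub_one_gcd_pow_sub_one]
    exact Nat.dvd_gcd ⟨v, by rw [hρ, mul_comm]⟩ hρn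
  have hkn : k0.gcd n ∣ n := Nat.gcd_dvd_right _ _
  generalize k0.gcd n = k at hk1 hρk hkn
  obtain ⟨v', hv'⟩ := hρk
  have hpk' : 0 < p^k := pow_pos hp.pos _
  have hpk1' : 0 < p^k - 1 := by
    have := Nat.one_lt_pow (by omega : k ≠ 0) hp.one_lt
    omega
  have hv0 : 0 < v' := by
    rcases Nat.eq_zero_or_pos v' with h | h
    · rw [h, mul_zero] at hv'; omega
    · exact h
  refine ⟨k, hkn, hk1, Finset.univ.filter (fun c => c^(p^k) = c), ⟨?_, ?_, ?_, ?_⟩, ?_, v', hv0, ⟨ρ, by rw [hv', mul_comm]⟩, ?_⟩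
  · exact Finset.mem_filter.mpr ⟨Finset.mem_univ _, zero_pow hpk'.ne'⟩
  · intro x hx y hy
    simp only [Finset.mem_filter, Finset.mem_univ, true_and] at *
    rw [add_pow_char_pow, hx, hy]
  · intro x hx
    simp only [Finset.mem_filter, Finset.mem_univ, true_and] at *
    have := sub_pow_char_pow (p := p) (n := k) (0:F) x
    rwa [zero_pow hpk'.ne', zero_sub, zero_sub, hx] at this
  · intro c hc x hx
    simp only [Finset.mem_filter, Finset.mem_univ, true_and] at *
    rw [mul_pow, hc, hx]
  · simp
  · ext s
    simp only [Finset.mem_image, Finset.mem_filter, Finset.mem_univ, true_and]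
    constructor
    · intro hs
      by_cases hs' : s = 0
      · exact ⟨0, zero_pow hpk'.ne', by simp [hs', hv0.ne']⟩
      · obtain ⟨w, hw⟩ := IsAlgClosed.exists_pow_nat_eq (algebraMap F K (s/s0)) hv0
        have e1 : w^(p^k - 1) = 1 := by
          rw [hv', mul_comm, pow_mul, hw, ← map_pow, hB s hs hs', map_one]
        have e2 : w^(p^k) = w := pow_of_dvd w _ _ hpk' e1 dvd_rfl
        obtain ⟨x, rfl⟩ := mem_range_of_pow (F := F) _ hq w (pow_iter w p k n e2 hkn)
        refine ⟨x, (algebraMap F K).injective (by rw [map_pow, e2]), ?_⟩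
        rw [← map_pow] at hw
        rw [(algebraMap F K).injective hw, mul_div_cancel₀ _ hs0']
    · rintro ⟨x, hx, rfl⟩
      by_cases hx0 : x = 0
      · simpa [hx0, hv0.ne'] using h0
      · have e1 := pow_sub_one_of x _ hpk' hx hx0
        obtain ⟨s, hs, e⟩ := hA (algebraMap F K (x^v')) (by
          rw [← map_pow, ← pow_mul, mul_comm, ← hv', e1, map_one])
        rw [← map_mul] at e
        rwa [(algebraMap F K).injective e]

lemma stepE (p n v : ℕ) [Fact p.Prime] [CharP F p] (hn : 1 ≤ n) (hq : Fintype.card F = p^n)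
    (hv : 0 < v) (hpv : ¬ p ∣ v) (S : Finset F) (h0 : 0 ∈ S) (s0 : F) (hs0 : s0 ∈ S) (hs0' : s0 ≠ 0)
    (hT : ∀ j, (∏ s ∈ S, (X - C s)).coeff j ≠ 0 → Adm p v j) :
    ∃ k, k ∣ n ∧ 1 ≤ k ∧ ∃ U : Finset F, (0 ∈ U ∧ (∀ x ∈ U, ∀ y ∈ U, x + y ∈ U) ∧ (∀ x ∈ U, -x ∈ U) ∧
      (∀ c : F, c^(p^k) = c → ∀ x ∈ U, c*x ∈ U)) ∧ 1 ∈ U ∧ ∃ v', 0 < v' ∧ v' ∣ p^k - 1 ∧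
       S = U.image (fun u => s0*u^v') := by
  have hp : p.Prime := Fact.out
  obtain ⟨k0, hk0, hvk, hk⟩ := exists_k0 p v hp hv hpv
  have : CharP (AlgebraicClosure F) p := charP_of_injective_algebraMap (algebraMap F (AlgebraicClosure F)).injective p
  obtain ⟨hadd, hsm⟩ := U_props (K := AlgebraicClosure F) p v k0 hv hk S h0 hT s0
  by_cases h : ∀ u : AlgebraicClosure F, (∃ s ∈ S, algebraMap F _ s0 * u^v = algebraMap F _ s) → u^(p^k0) = u
  · exact case2 p v k0 n hv hk0 hn hvk hq S h0 s0 hs0 hs0' hsm h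
  · push Not at h
    obtain ⟨u, hu, hu'⟩ := h
    obtain ⟨h1, U, h2, h3, h4⟩ := case1 p v k0 n hv hpv hvk hk hq S h0 s0 hs0 hs0' hadd hsm u hu hu'
    exact ⟨k0, h1, hk0, U, h2, h3, v, hv, hvk, h4⟩
end E
end MV

namespace MV

section Fr
variable {F : Type*} [Field F] [Fintype F] [DecidableEq F]

lemma card_img (p n k v : ℕ) [Fact p.Prime] [CharP F p] (hq : Fintype.card F = p^n) (hkn : k ∣ n)
    (hk : 1 ≤ k)
    (U : Finset F) (h0 : 0 ∈ U) (hsm : ∀ c : F, c^(p^k) = c → ∀ x ∈ U, c*x ∈ U)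
    (hv : 0 < v) (hvk : v ∣ p^k - 1) (a b : F) (ha : a ≠ 0) :
    ∃ M, U.card = v*M + 1 ∧ (U.image (fun u => a*u^v+b)).card = M + 1 := by
  have hp : p.Prime := Fact.out
  have hpk : 0 < p^k := pow_pos hp.pos _
  have hpn : 0 < p^n := pow_pos hp.pos _
  have hvp : ¬ p ∣ v := by
    intro h
    have h2 : p ∣ p^k - 1 := h.trans hvk
    have h3 : p ∣ p^k := dvd_pow_self _ (by omega)
    have := (Nat.dvd_sub_iff_right (by omega) h3).mp h2
    exact hp.one_lt.ne' (Nat.dvd_one.mp this)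
  have hprim : ∃ z : F, IsPrimitiveRoot z v := by
    have : CharP (AlgebraicClosure F) p := charP_of_injective_algebraMap (algebraMap F (AlgebraicClosure F)).injective p
    have : NeZero (v:AlgebraicClosure F) := ⟨by rw [Ne, cast_zero p]; exact hvp⟩
    obtain ⟨z, hz⟩ := HasEnoughRootsOfUnity.exists_primitiveRoot (AlgebraicClosure F) v
    obtain ⟨x, rfl⟩ := mem_range_of_pow (F := F) _ hq z
      (pow_iter z p k n (pow_of_dvd _ v _ hpk hz.pow_eq_one hvk) hkn)
    exact ⟨x, hz.of_map_of_injective (algebraMap F (AlgebraicClosure F)).injective⟩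
  obtain ⟨z, hz⟩ := hprim
  have hcard := hz.card_nthRootsFinset
  set g : F → F := fun u => a*u^v+b with hg
  have hU : U = insert 0 (U.erase 0) := (Finset.insert_erase h0).symm
  have hg0 : g 0 = b := by simp [hg, hv.ne']
  have himg : U.image g = insert b ((U.erase 0).image g) := by
    conv_lhs => rw [hU, Finset.image_insert, hg0]
  have hnot : b ∉ (U.erase 0).image g := by
    simp [hg, ha, hv.ne']
  have hfib : ∀ y ∈ (U.erase 0).image g, ((U.erase 0).filter (fun u => g u = y)).card = v := by
    intro y hy
    obtain ⟨u0, hu0, rfl⟩ := Finset.mem_image.mp hy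
    obtain ⟨hu1, hu2⟩ := Finset.mem_erase.mp hu0
    rw [← hcard]
    symm
    apply Finset.card_bij (fun ζ _ => ζ * u0)
    · intro ζ hζ
      rw [mem_nthRootsFinset hv] at hζ
      simp only [Finset.mem_filter, Finset.mem_erase]
      refine ⟨⟨?_, hsm _ (pow_of_dvd _ v _ hpk hζ hvk) _ hu2⟩, ?_⟩
      · apply mul_ne_zero _ hu1
        rintro rfl
        simp [hv.ne'] at hζ
      · simp only [hg]; rw [mul_pow, hζ, one_mul]
    · intro x _ y _ h
      exact mul_right_cancel₀ hu1 h
    · intro u hu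
      simp only [Finset.mem_filter, Finset.mem_erase, hg] at hu
      have e : u^v = u0^v := mul_left_cancel₀ ha (add_right_cancel hu.2)
      refine ⟨u/u0, ?_, div_mul_cancel₀ _ hu1⟩
      rw [mem_nthRootsFinset hv, div_pow, e, div_self (pow_ne_zero _ hu1)]
  refine ⟨((U.erase 0).image g).card, ?_, ?_⟩
  · have := Finset.card_eq_sum_card_image g (U.erase 0)
    rw [Finset.sum_congr rfl hfib, Finset.sum_const, smul_eq_mul, mul_comm] at this
    rw [← this, Finset.card_erase_add_one h0]
  · rw [himg, Finset.card_insert_of_notMem hnot]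

lemma exists_L (p n : ℕ) [Fact p.Prime] [CharP F p] (hq : Fintype.card F = p^n)
    (U : Finset F) (h0 : 0 ∈ U) (hadd : ∀ x ∈ U, ∀ y ∈ U, x + y ∈ U) (hneg : ∀ x ∈ U, -x ∈ U) :
    ∃ D s : ℕ, s + D = n ∧ U.card = p^s ∧ ∃ c : Fin (D+1) → F, c ≠ 0 ∧
      ∀ x : F, ∑ i, c i * x^(p^(i:ℕ)) ∈ U := by
  have hp : p.Prime := Fact.out
  letI : Algebra (ZMod p) F := ZMod.algebra F p
  let A : AddSubgroup F := { carrier := U, zero_mem' := h0, add_mem' := fun {x y} hx hy => hadd x hx y hy, neg_mem' := fun {x} hx => hneg x hx }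
  let W : Submodule (ZMod p) F := AddSubgroup.toZModSubmodule p A
  have hW : ∀ x, x ∈ W ↔ x ∈ U := fun x => Iff.rfl
  have hfin : Module.finrank (ZMod p) F = n := by
    have h := Module.card_eq_pow_finrank (K := ZMod p) (V := F)
    rw [hq, ZMod.card] at h
    exact (Nat.pow_right_injective hp.two_le h).symm
  have hs := Submodule.finrank_quotient_add_finrank W
  have hUc : U.card = p^(Module.finrank (ZMod p) W) := by
    have h := Module.natCard_eq_pow_finrank (K := ZMod p) (V := W)
    rw [Nat.card_zmod] at h
    rw [← h]
    have : Nat.card W = Nat.card U := rfl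
    rw [this]; simp
  refine ⟨Module.finrank (ZMod p) (F ⧸ W), Module.finrank (ZMod p) W, by rw [← hfin, ← hs, add_comm], hUc, ?_⟩
  generalize hD : Module.finrank (ZMod p) (F ⧸ W) = D
  let Φ : (Fin (D+1) → F) →ₗ[ZMod p] F →ₗ[ZMod p] (F ⧸ W) :=
    LinearMap.mk₂ (ZMod p) (fun c x => W.mkQ (∑ i, c i * x^(p^(i:ℕ))))
      (by intro c c' x
          rw [← map_add, ← Finset.sum_add_distrib]
          simp [add_mul])
      (by intro r c x
          rw [← map_smul, Finset.smul_sum]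
          simp)
      (by intro c x y
          rw [← map_add, ← Finset.sum_add_distrib]
          simp [add_pow_char_pow, mul_add])
      (by intro r c x
          rw [← map_smul, Finset.smul_sum]
          congr 1
          apply Finset.sum_congr rfl
          intro i _
          rw [_root_.smul_pow, ZMod.pow_card_pow, mul_smul_comm])
  have hlt : Module.finrank (ZMod p) (F →ₗ[ZMod p] (F ⧸ W)) < Module.finrank (ZMod p) (Fin (D+1) → F) := by
    rw [Module.finrank_linearMap, Module.finrank_pi_fintype, hD]
    simp only [Finset.sum_const, Finset.card_univ, Fintype.card_fin, smul_eq_mul]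
    have : 0 < Module.finrank (ZMod p) F := Module.finrank_pos
    nlinarith
  have hker := LinearMap.ker_ne_bot_of_finrank_lt (f := Φ) hlt
  obtain ⟨c, hc, hc0⟩ := Submodule.exists_mem_ne_zero_of_ne_bot hker
  refine ⟨c, hc0, fun x => ?_⟩
  rw [← hW, ← Submodule.Quotient.mk_eq_zero]
  have := congrArg (fun φ => φ x) (LinearMap.mem_ker.mp hc)
  exact this

lemma rev (p n k v : ℕ) [Fact p.Prime] [CharP F p] (hq : Fintype.card F = p^n) (hkn : k ∣ n)
    (hk : 1 ≤ k)
    (U : Finset F) (h0 : 0 ∈ U) (hadd : ∀ x ∈ U, ∀ y ∈ U, x + y ∈ U) (hneg : ∀ x ∈ U, -x ∈ U)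
    (hsm : ∀ c : F, c^(p^k) = c → ∀ x ∈ U, c*x ∈ U)
    (hv : 0 < v) (hvk : v ∣ p^k - 1) (a b : F) (ha : a ≠ 0) :
    ∃ f : F[X], 0 < f.natDegree ∧ Finset.univ.image (fun x => f.eval x) = U.image (fun u => a*u^v+b) ∧
      (U.image (fun u => a*u^v+b)).card = (Fintype.card F - 1)/f.natDegree + 1 := by
  have hp : p.Prime := Fact.out
  obtain ⟨D, s, hsD, hUc, c, hc0, hc⟩ := exists_L p n hq U h0 hadd hneg
  obtain ⟨M, hM1, hM2⟩ := card_img p n k v hq hkn hk U h0 hsm hv hvk a b ha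
  set L : F[X] := ∑ i : Fin (D+1), C (c i) * X^(p^(i:ℕ)) with hL
  have hev : ∀ x, L.eval x = ∑ i, c i * x^(p^(i:ℕ)) := by
    intro x; simp [hL, eval_finsetSum]
  have hL0 : L ≠ 0 := by
    obtain ⟨i, hi⟩ := Function.ne_iff.mp hc0
    intro h
    apply hi
    have : L.coeff (p^(i:ℕ)) = c i := by
      rw [hL, finsetSum_coeff, Finset.sum_eq_single i]
      · simp
      · intro j _ hj
        rw [coeff_C_mul, coeff_X_pow, if_neg, mul_zero]
        intro h
        exact hj (Fin.ext (Nat.pow_right_injective hp.two_le h.symm))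
      · simp
    rw [← this, h]; simp
  have hdle : L.natDegree ≤ p^D := by
    apply natDegree_sum_le_of_forall_le
    intro i _
    refine (natDegree_C_mul_X_pow_le _ _).trans ?_
    exact Nat.pow_le_pow_right hp.pos (by omega)
  have hdpos : 0 < L.natDegree := by
    by_contra h
    have h1 := eq_C_of_natDegree_eq_zero (by omega : L.natDegree = 0)
    have h2 : L.eval 0 = 0 := by
      rw [hev]; apply Finset.sum_eq_zero
      intro i _
      rw [zero_pow (pow_pos hp.pos _).ne', mul_zero]
    rw [h1, eval_C] at h2
    rw [h2, C_0] at h1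
    exact hL0 h1
  have himgle : Finset.univ.image (fun x => L.eval x) ⊆ U := by
    intro y hy
    obtain ⟨x, _, rfl⟩ := Finset.mem_image.mp hy
    rw [hev]; exact hc x
  have hle : p^n ≤ L.natDegree * (Finset.univ.image (fun x => L.eval x)).card := by
    rw [← hq, ← Finset.card_univ]
    apply Finset.card_le_mul_card_image
    intro y _
    exact fiber_le L hdpos y
  have hcl := Finset.card_le_card himgle
  have hpp : p^n = p^D * U.card := by rw [hUc, ← pow_add, ← hsD, add_comm]
  have hUpos : 0 < U.card := Finset.card_pos.mpr ⟨0, h0⟩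
  have hDpos : 0 < p^D := pow_pos hp.pos _
  have hdeq : L.natDegree = p^D := by
    apply le_antisymm hdle
    have : p^D * U.card ≤ L.natDegree * U.card := by
      rw [← hpp]; exact hle.trans (Nat.mul_le_mul_left _ hcl)
    exact Nat.le_of_mul_le_mul_right this hUpos
  have himg : Finset.univ.image (fun x => L.eval x) = U := by
    apply Finset.eq_of_subset_of_card_le himgle
    rw [hpp, hdeq] at hle
    exact Nat.le_of_mul_le_mul_left hle hDpos
  have hfd : (C a * L^v + C b).natDegree = v * p^D := by
    rw [natDegree_add_C, natDegree_C_mul ha, natDegree_pow, hdeq]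
  refine ⟨C a * L^v + C b, ?_, ?_, ?_⟩
  · rw [hfd]; positivity
  · conv_rhs => rw [← himg, Finset.image_image]
    congr 1
    ext x
    simp
  · rw [hM2, hfd, hq, hpp, hM1]
    congr 1
    symm
    apply Nat.div_eq_of_lt_le
    · have : M * (v * p^D) = p^D * (v*M) := by ring
      rw [this, mul_add]; omega
    · have : (M+1) * (v * p^D) = p^D * (v*M) + p^D * v := by ring
      rw [this, mul_add]
      have : p^D * 1 ≤ p^D * v := Nat.mul_le_mul_left _ hv
      omega
end Fr
end MV

/-- `𝒫(S, q) ≠ ∅` iff `S = a · U^v + b` for a subspace `U` over a subfield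
`𝔽_{p^k}` with `1 ∈ U` and a divisor `v` of `p^k - 1`. -/
theorem stmt_0 (p n : ℕ) (hp : p.Prime) (hn : 0 < n)
    (F : Type) [Field F] [Fintype F] [DecidableEq F]
    (hcard : Fintype.card F = p ^ n)
    (S : Finset F) (hS : 2 < S.card) :
    (∃ f : F[X], f ∈ MVSPset S) ↔
      ∃ k : ℕ, k ∣ n ∧ 1 ≤ k ∧
        ∃ U : Finset F, IsSubspaceOver (p ^ k) (↑U : Set F) ∧ (1 : F) ∈ U ∧
          ∃ v : ℕ, 0 < v ∧ v ∣ p ^ k - 1 ∧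
            ∃ a b : F, a ≠ 0 ∧ S = U.image (fun u => a * u ^ v + b) := by
  have : Fact p.Prime := ⟨hp⟩
  have : CharP F p := charP_of_card_eq_prime_pow hcard
  have hpn : 0 < p^n := pow_pos hp.pos _
  constructor
  · rintro ⟨f, ⟨hd, hc⟩, hV⟩
    rw [hV, hcard] at hc
    obtain ⟨r, hr⟩ : ∃ r, r = (p^n-1)/f.natDegree := ⟨_, rfl⟩
    rw [← hr] at hc
    have hr2 : 2 ≤ r := by omega
    have hrd : r * f.natDegree < p^n := by
      have := Nat.div_mul_le_self (p^n-1) f.natDegree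
      rw [← hr] at this
      omega
    have hrd2 : p^n ≤ (r+1) * f.natDegree := by
      have := Nat.lt_mul_of_div_lt (by rw [← hr]; exact Nat.lt_succ_self r : (p^n-1)/f.natDegree < r+1) hd
      have h2 := mul_comm f.natDegree (r+1)
      omega
    have hfS : ∀ a, f.eval a ∈ S := by
      intro a
      rw [← hV]
      exact Finset.mem_image_of_mem _ (Finset.mem_univ _)
    have hSf : ∀ s ∈ S, ∃ a, f.eval a = s := by
      intro s hs
      rw [← hV] at hs
      obtain ⟨a, _, h⟩ := Finset.mem_image.mp hs
      exact ⟨a, h⟩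
    obtain ⟨γ0, hγ0, hγ⟩ := MV.exists_gamma f hd S hfS r hr2 hc (by rw [hcard]; exact hrd)
    have hinj : Function.Injective (fun s : F => s - γ0) := fun x y h => sub_left_injective h
    have hdd : (f - C γ0).natDegree = f.natDegree := natDegree_sub_C
    have hc' : (S.image (fun s => s - γ0)).card = r + 1 := by
      rw [Finset.card_image_of_injective _ hinj, hc]
    have h00 : (0:F) ∈ S.image (fun s => s - γ0) :=
      Finset.mem_image.mpr ⟨γ0, hγ0, sub_self _⟩
    obtain ⟨v, hv, hpv, hT⟩ := MV.fwd p n r hn hcard (f - C γ0) (by rw [hdd]; exact hd)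
      (S.image (fun s => s - γ0))
      (fun a => by
        rw [eval_sub, eval_C]
        exact Finset.mem_image_of_mem (fun s => s - γ0) (hfS a))
      hr2 hc' (by rw [hdd]; exact hrd) (by rw [hdd]; exact hrd2) h00
      (by
        obtain ⟨a, ha⟩ := hSf γ0 hγ0
        exact ⟨a, by simp [ha]⟩)
      (by
        intro γ hγS hγne
        obtain ⟨s, hs, rfl⟩ := Finset.mem_image.mp hγS
        obtain ⟨a, h1, h2⟩ := hγ s hs (sub_ne_zero.mp hγne)
        exact ⟨a, by simp [h1], by simpa using h2⟩)
    obtain ⟨s0, hs0, hs0'⟩ := Finset.exists_mem_ne (by omega : 1 < (S.image (fun s => s - γ0)).card) 0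
    obtain ⟨k, hkn, hk1, U, hU, h1U, v', hv', hvk, hSU⟩ :=
      MV.stepE p n v hn hcard hv hpv _ h00 s0 hs0 hs0' hT
    refine ⟨k, hkn, hk1, U, hU, h1U, v', hv', hvk, s0, γ0, hs0', ?_⟩
    have : S = (S.image (fun s => s - γ0)).image (fun s => s + γ0) := by
      rw [Finset.image_image]
      ext x
      simp
    rw [this, hSU, Finset.image_image]
    rfl
  · rintro ⟨k, hkn, hk1, U, ⟨h0, hadd, hneg, hsm⟩, _, v, hv, hvk, a, b, ha, rfl⟩
    obtain ⟨f, h1, h2, h3⟩ := MV.rev p n k v hcard hkn hk1 U h0 hadd hneg hsm hv hvk a b ha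
    refine ⟨f, ⟨h1, ?_⟩, h2⟩
    unfold valueSet
    rw [h2, h3]
end

section
/- Let p be a prime, n ≥ 1, q = p^n, k a divisor of n, and let U be an 𝔽_{p^k}-subspace of 𝔽_q with #U = p^{mk} for a positive integer m. If v is a positive divisor of p^k − 1, then #U^v = (p^{mk} − 1)/v + 1. In particular, #U^v > 2 if and only if (m, v) ≠ (1, p^k − 1). -/
open Polynomial

/-- `#U^v = (p^{mk} - 1)/v + 1`, and `#U^v > 2 ↔ (m, v) ≠ (1, p^k - 1)`. -/
theorem stmt_1 (p n k m v : ℕ) (hp : p.Prime) (hn : 0 < n) (hk : k ∣ n)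
    (hm : 0 < m) (hv : 0 < v) (hvd : v ∣ p ^ k - 1)
    (F : Type) [Field F] [Fintype F] [DecidableEq F]
    (hcard : Fintype.card F = p ^ n)
    (U : Finset F) (hU : IsSubspaceOver (p ^ k) (↑U : Set F))
    (hUcard : U.card = p ^ (m * k)) :
    (U.image (fun u => u ^ v)).card = (p ^ (m * k) - 1) / v + 1 ∧
      (2 < (U.image (fun u => u ^ v)).card ↔ (m, v) ≠ (1, p ^ k - 1)) := by
  obtain ⟨h0, -, -, hmul⟩ := hU
  have hk0 : 0 < k := Nat.pos_of_dvd_of_pos hk hn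
  have hpp := hp.one_lt
  have hvn : v ∣ p ^ n - 1 := by
    obtain ⟨d, rfl⟩ := hk
    exact hvd.trans (by simpa [pow_mul] using Nat.sub_dvd_pow_sub_pow (p ^ k) 1 d)
  have hvm : v ∣ p ^ (m * k) - 1 :=
    hvd.trans (by simpa [mul_comm m k, pow_mul] using Nat.sub_dvd_pow_sub_pow (p ^ k) 1 m)
  -- primitive root
  obtain ⟨g, hg⟩ := IsCyclic.exists_ofOrder_eq_natCard (α := Fˣ)
  have hcu : Nat.card Fˣ = p ^ n - 1 := by
    rw [Nat.card_units, Nat.card_eq_fintype_card, hcard]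
  have hnpos : 0 < p ^ n - 1 := by
    have := Nat.one_lt_pow hn.ne' hpp
    omega
  obtain ⟨e, he⟩ := hvn
  have hprim : IsPrimitiveRoot ((g : F) ^ e) v := by
    have h1 : IsPrimitiveRoot (g : F) (p ^ n - 1) := by
      rw [IsPrimitiveRoot.coe_units_iff, ← hcu, ← hg]
      exact IsPrimitiveRoot.orderOf g
    exact h1.pow hnpos (by rw [he, mul_comm])
  have hroots := hprim.card_nthRootsFinset
  have hfib : ∀ b ∈ (U.erase 0).image (fun u => u ^ v),
      ((U.erase 0).filter (fun u => u ^ v = b)).card = v := by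
    intro b hb
    obtain ⟨u, hu, rfl⟩ := Finset.mem_image.1 hb
    obtain ⟨hu0, huU⟩ := Finset.mem_erase.1 hu
    have : (U.erase 0).filter (fun w => w ^ v = u ^ v)
        = (Polynomial.nthRootsFinset v (1 : F)).image (fun c => c * u) := by
      ext w
      simp only [Finset.mem_filter, Finset.mem_erase, Finset.mem_image,
        Polynomial.mem_nthRootsFinset hv]
      constructor
      · rintro ⟨⟨hw0, hwU⟩, hw⟩
        refine ⟨w / u, ?_, by field_simp⟩
        rw [div_pow, hw, div_self (pow_ne_zero _ hu0)]
      · rintro ⟨c, hc, rfl⟩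
        have hc0 : c ≠ 0 := by
          rintro rfl
          rw [zero_pow hv.ne'] at hc
          exact zero_ne_one hc
        refine ⟨⟨mul_ne_zero hc0 hu0, ?_⟩, by rw [mul_pow, hc, one_mul]⟩
        refine hmul c ?_ u huU
        obtain ⟨d, hd⟩ := hvd
        have hpk := Nat.one_lt_pow hk0.ne' hpp
        have : p ^ k = v * d + 1 := by omega
        rw [this, pow_succ, pow_mul, hc, one_pow, one_mul]
    rw [this, Finset.card_image_of_injective _ (mul_left_injective₀ hu0), hroots]
  have hcount : (U.erase 0).card = ((U.erase 0).image (fun u => u ^ v)).card * v := by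
    rw [Finset.card_eq_sum_card_image (fun u => u ^ v) (U.erase 0),
      Finset.sum_congr rfl hfib, Finset.sum_const, smul_eq_mul]
  have h0U : (0 : F) ∈ U := h0
  have himg : (U.image (fun u => u ^ v)).card = ((U.erase 0).image (fun u => u ^ v)).card + 1 := by
    conv_lhs => rw [← Finset.insert_erase h0U, Finset.image_insert]
    rw [Finset.card_insert_of_notMem]
    rw [zero_pow hv.ne', Finset.mem_image]
    rintro ⟨u, hu, hu'⟩
    exact (Finset.mem_erase.1 hu).1 (pow_eq_zero_iff hv.ne' |>.1 hu')
  rw [Finset.card_erase_of_mem h0U, hUcard] at hcount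
  have hmain : (U.image (fun u => u ^ v)).card = (p ^ (m * k) - 1) / v + 1 := by
    rw [himg, hcount, Nat.mul_div_cancel _ hv]
  refine ⟨hmain, ?_⟩
  rw [himg]
  generalize ((U.erase 0).image (fun u => u ^ v)).card = t at hcount
  have hpk := Nat.one_lt_pow hk0.ne' hpp
  have hle : p ^ k ≤ p ^ (m * k) := Nat.pow_le_pow_right hp.pos (Nat.le_mul_of_pos_left k hm)
  have hvle : v ≤ p ^ k - 1 := Nat.le_of_dvd (by omega) hvd
  have ht : t ≠ 0 := by
    rintro rfl
    omega
  constructor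
  · rintro h heq
    obtain ⟨rfl, rfl⟩ := Prod.mk.inj heq
    rw [one_mul] at hcount
    nlinarith
  · intro h
    by_contra hlt
    have : t = 1 := by omega
    subst this
    have hpe : p ^ (m * k) = p ^ k := by omega
    have hmk : m * k = k := Nat.pow_right_injective hpp hpe
    have hm1 : m = 1 := Nat.eq_of_mul_eq_mul_right hk0 (by rw [hmk, one_mul])
    exact h (Prod.ext hm1 (by simp only; omega))
end
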